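/- The random code capacity C* of a primitive AVRC satisfies R_DF* ≤ C* ≤ R_CS*, where R_DF* and R_CS* are the partial decode-forward and cutset bounds evaluated with the state set equal to the whole simplex P(S): R_DF* = max_{p(u,x)} min{ min_{q∈P(S)} I_q(U;Y) + min_{q∈P(S)} I_q(X;Y|U) + C_1, min_{q∈P(S)} I_q(U;Y_1) + min_{q∈P(S)} I_q(X;Y|U) } and R_CS* = min_{q∈P(S)} max_{p(x)} min{ I_q(X;Y) + C_1, I_q(X;Y,Y_1) }. -/

import Mathlib

open scoped BigOperators ENNReal

noncomputable section

/-- `p` is a probability mass function on a finite type. -/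
def IsPMF {α : Type} [Fintype α] (p : α → ℝ) : Prop :=
  (∀ a, 0 ≤ p a) ∧ ∑ a, p a = 1

/-- `W` is a channel: each `W x s` is a pmf on the output alphabet. -/
def IsChannel {𝒳 𝒮 𝒵 : Type} [Fintype 𝒵] (W : 𝒳 → 𝒮 → 𝒵 → ℝ) : Prop :=
  ∀ x s, IsPMF (W x s)

/-- Shannon entropy (base 2). By the convention `log₂ 0 = 0` in Mathlib, terms with
`p a = 0` contribute `0`. -/
def ent {α : Type} [Fintype α] (p : α → ℝ) : ℝ :=
  -∑ a, p a * Real.logb 2 (p a)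

/-- Mutual information of a joint pmf on a product of finite types. -/
def mutInfo {α β : Type} [Fintype α] [Fintype β] (p : α × β → ℝ) : ℝ :=
  ent (fun a => ∑ b, p (a, b)) + ent (fun b => ∑ a, p (a, b)) - ent p

/-- Conditional mutual information `I(X;Y|U)` of a joint pmf on `U × X × Y`,
via `I(X;Y|U) = H(U,X) + H(U,Y) − H(U,X,Y) − H(U)`. -/
def condMutInfo {υ α β : Type} [Fintype υ] [Fintype α] [Fintype β]
    (p : υ × α × β → ℝ) : ℝ :=
  ent (fun ua : υ × α => ∑ b, p (ua.1, ua.2, b))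
    + ent (fun ub : υ × β => ∑ a, p (ub.1, a, ub.2))
    - ent p
    - ent (fun u : υ => ∑ a, ∑ b, p (u, a, b))

section InfoQuantities

variable {𝒳 𝒮 𝒴 𝒴₁ : Type} [Fintype 𝒳] [Fintype 𝒮] [Fintype 𝒴] [Fintype 𝒴₁]

/-- `I_q(X;Y)` under input pmf `p(x)`, state pmf `q(s)` and channel `W`. -/
def IqXY (W : 𝒳 → 𝒮 → 𝒴 × 𝒴₁ → ℝ) (p : 𝒳 → ℝ) (q : 𝒮 → ℝ) : ℝ :=
  mutInfo (fun xy : 𝒳 × 𝒴 => p xy.1 * ∑ s, q s * ∑ y1, W xy.1 s (xy.2, y1))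

/-- `I_q(X;Y,Y₁)`. -/
def IqXYY1 (W : 𝒳 → 𝒮 → 𝒴 × 𝒴₁ → ℝ) (p : 𝒳 → ℝ) (q : 𝒮 → ℝ) : ℝ :=
  mutInfo (fun xz : 𝒳 × (𝒴 × 𝒴₁) => p xz.1 * ∑ s, q s * W xz.1 s xz.2)

/-- `I_q(U;Y)` under input pmf `p(u,x)` (auxiliary alphabet `Fin k`). -/
def IqUY {k : ℕ} (W : 𝒳 → 𝒮 → 𝒴 × 𝒴₁ → ℝ) (p : Fin k × 𝒳 → ℝ) (q : 𝒮 → ℝ) : ℝ :=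
  mutInfo (fun uy : Fin k × 𝒴 => ∑ x, ∑ s, ∑ y1, p (uy.1, x) * q s * W x s (uy.2, y1))

/-- `I_q(U;Y₁)` under input pmf `p(u,x)`. -/
def IqUY1 {k : ℕ} (W : 𝒳 → 𝒮 → 𝒴 × 𝒴₁ → ℝ) (p : Fin k × 𝒳 → ℝ) (q : 𝒮 → ℝ) : ℝ :=
  mutInfo (fun uy : Fin k × 𝒴₁ => ∑ x, ∑ s, ∑ y, p (uy.1, x) * q s * W x s (y, uy.2))

/-- `I_q(X;Y|U)` under input pmf `p(u,x)`. -/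
def IqXYgivenU {k : ℕ} (W : 𝒳 → 𝒮 → 𝒴 × 𝒴₁ → ℝ) (p : Fin k × 𝒳 → ℝ) (q : 𝒮 → ℝ) : ℝ :=
  condMutInfo (fun uxy : Fin k × 𝒳 × 𝒴 =>
    p (uxy.1, uxy.2.1) * ∑ s, q s * ∑ y1, W uxy.2.1 s (uxy.2.2, y1))

/-- The partial decode-forward lower bound `R_DF(Q)`: the supremum over all finite
auxiliary alphabets (represented by `Fin k`) and input pmfs `p(u,x)` of
`min{ inf_q I_q(U;Y) + inf_q I_q(X;Y|U) + C₁, inf_q I_q(U;Y₁) + inf_q I_q(X;Y|U) }`. -/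
def RDF (W : 𝒳 → 𝒮 → 𝒴 × 𝒴₁ → ℝ) (C1 : ℝ) (Q : Set (𝒮 → ℝ)) : ℝ :=
  sSup {r | ∃ (k : ℕ) (p : Fin k × 𝒳 → ℝ), IsPMF p ∧
    r = min
      (sInf {v | ∃ q ∈ Q, v = IqUY W p q} + sInf {v | ∃ q ∈ Q, v = IqXYgivenU W p q} + C1)
      (sInf {v | ∃ q ∈ Q, v = IqUY1 W p q} + sInf {v | ∃ q ∈ Q, v = IqXYgivenU W p q})}

/-- The cutset upper bound
`R_CS(Q) = inf_{q∈Q} max_{p(x)} min{ I_q(X;Y) + C₁, I_q(X;Y,Y₁) }`. -/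
def RCS (W : 𝒳 → 𝒮 → 𝒴 × 𝒴₁ → ℝ) (C1 : ℝ) (Q : Set (𝒮 → ℝ)) : ℝ :=
  sInf {r | ∃ q ∈ Q, r = sSup {v | ∃ p : 𝒳 → ℝ, IsPMF p ∧
    v = min (IqXY W p q + C1) (IqXYY1 W p q)}}

end InfoQuantities

/-- A deterministic code for the primitive relay channel: a message encoder, a relay
function mapping the relay's received block to one of `L` indices sent over the
noiseless link, and a decoder using the channel output together with that index. -/
structure PCode (𝒳 𝒴 𝒴₁ : Type) (n M L : ℕ) where
  f : Fin M → Fin n → 𝒳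
  f1 : (Fin n → 𝒴₁) → Fin L
  g : (Fin n → 𝒴) × Fin L → Fin M

/-- The noiseless link of rate `C₁` supports `L` indices when `L ≤ 2^{nC₁}`. -/
def LinkOK (n L : ℕ) (C1 : ℝ) : Prop := 1 ≤ L ∧ (L : ℝ) ≤ (2 : ℝ) ^ ((n : ℝ) * C1)

section Codes

variable {𝒳 𝒮 𝒴 𝒴₁ : Type} [Fintype 𝒳] [Fintype 𝒮] [Fintype 𝒴] [Fintype 𝒴₁]
variable {n M L : ℕ}

/-- Conditional probability of error of the code given the state sequence `s`. -/
def PCode.errGiven (C : PCode 𝒳 𝒴 𝒴₁ n M L) (W : 𝒳 → 𝒮 → 𝒴 × 𝒴₁ → ℝ)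
    (s : Fin n → 𝒮) : ℝ :=
  (M : ℝ)⁻¹ * ∑ m : Fin M, ∑ y : Fin n → 𝒴, ∑ y1 : Fin n → 𝒴₁,
    if C.g (y, C.f1 y1) = m then 0 else ∏ i, W (C.f m i) (s i) (y i, y1 i)

/-- Average error probability under an i.i.d. state distribution `q`. -/
def PCode.errIID (C : PCode 𝒳 𝒴 𝒴₁ n M L) (W : 𝒳 → 𝒮 → 𝒴 × 𝒴₁ → ℝ)
    (q : 𝒮 → ℝ) : ℝ :=
  ∑ s : Fin n → 𝒮, (∏ i, q (s i)) * C.errGiven W s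

/-- Average error probability under an arbitrary joint state distribution `qn`. -/
def PCode.errJoint (C : PCode 𝒳 𝒴 𝒴₁ n M L) (W : 𝒳 → 𝒮 → 𝒴 × 𝒴₁ → ℝ)
    (qn : (Fin n → 𝒮) → ℝ) : ℝ :=
  ∑ s : Fin n → 𝒮, qn s * C.errGiven W s

end Codes

section Capacities

variable {𝒳 𝒮 𝒴 𝒴₁ : Type} [Fintype 𝒳] [Fintype 𝒮] [Fintype 𝒴] [Fintype 𝒴₁]

/-- `R` is achievable by deterministic codes over the compound primitive relay
channel with state set `Q`. -/
def CompAchievable (W : 𝒳 → 𝒮 → 𝒴 × 𝒴₁ → ℝ) (C1 : ℝ) (Q : Set (𝒮 → ℝ)) (R : ℝ) : Prop :=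
  ∀ ε > (0 : ℝ), ∃ N : ℕ, ∀ n ≥ N, ∃ (M L : ℕ) (C : PCode 𝒳 𝒴 𝒴₁ n M L),
    (2 : ℝ) ^ ((n : ℝ) * R) ≤ (M : ℝ) ∧ LinkOK n L C1 ∧
    ∀ q ∈ Q, C.errIID W q ≤ ε

/-- The deterministic code capacity of the compound primitive relay channel. -/
def CompCapacity (W : 𝒳 → 𝒮 → 𝒴 × 𝒴₁ → ℝ) (C1 : ℝ) (Q : Set (𝒮 → ℝ)) : ℝ :=
  sSup {R | CompAchievable W C1 Q R}

/-- `R` is achievable by random codes over the compound primitive relay channel. -/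
def CompRandAchievable (W : 𝒳 → 𝒮 → 𝒴 × 𝒴₁ → ℝ) (C1 : ℝ) (Q : Set (𝒮 → ℝ)) (R : ℝ) :
    Prop :=
  ∀ ε > (0 : ℝ), ∃ N : ℕ, ∀ n ≥ N, ∃ (M L : ℕ),
    (2 : ℝ) ^ ((n : ℝ) * R) ≤ (M : ℝ) ∧ LinkOK n L C1 ∧
    ∃ (J : Type) (π : PMF J) (Cs : J → PCode 𝒳 𝒴 𝒴₁ n M L),
      ∀ q ∈ Q, (∑' j, π j * ENNReal.ofReal ((Cs j).errIID W q)) ≤ ENNReal.ofReal ε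

/-- The random code capacity of the compound primitive relay channel. -/
def CompRandCapacity (W : 𝒳 → 𝒮 → 𝒴 × 𝒴₁ → ℝ) (C1 : ℝ) (Q : Set (𝒮 → ℝ)) : ℝ :=
  sSup {R | CompRandAchievable W C1 Q R}

/-- `R` is achievable by deterministic codes over the primitive AVRC: the average
error is small under every joint state distribution. -/
def AVRCAchievable (W : 𝒳 → 𝒮 → 𝒴 × 𝒴₁ → ℝ) (C1 R : ℝ) : Prop :=
  ∀ ε > (0 : ℝ), ∃ N : ℕ, ∀ n ≥ N, ∃ (M L : ℕ) (C : PCode 𝒳 𝒴 𝒴₁ n M L),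
    (2 : ℝ) ^ ((n : ℝ) * R) ≤ (M : ℝ) ∧ LinkOK n L C1 ∧
    ∀ qn : (Fin n → 𝒮) → ℝ, IsPMF qn → C.errJoint W qn ≤ ε

/-- The deterministic code capacity of the primitive AVRC. -/
def AVRCCapacity (W : 𝒳 → 𝒮 → 𝒴 × 𝒴₁ → ℝ) (C1 : ℝ) : ℝ :=
  sSup {R | AVRCAchievable W C1 R}

/-- `R` is achievable by random codes over the primitive AVRC. -/
def AVRCRandAchievable (W : 𝒳 → 𝒮 → 𝒴 × 𝒴₁ → ℝ) (C1 R : ℝ) : Prop :=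
  ∀ ε > (0 : ℝ), ∃ N : ℕ, ∀ n ≥ N, ∃ (M L : ℕ),
    (2 : ℝ) ^ ((n : ℝ) * R) ≤ (M : ℝ) ∧ LinkOK n L C1 ∧
    ∃ (J : Type) (π : PMF J) (Cs : J → PCode 𝒳 𝒴 𝒴₁ n M L),
      ∀ qn : (Fin n → 𝒮) → ℝ, IsPMF qn →
        (∑' j, π j * ENNReal.ofReal ((Cs j).errJoint W qn)) ≤ ENNReal.ofReal ε

/-- The random code capacity of the primitive AVRC. -/
def AVRCRandCapacity (W : 𝒳 → 𝒮 → 𝒴 × 𝒴₁ → ℝ) (C1 : ℝ) : ℝ :=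
  sSup {R | AVRCRandAchievable W C1 R}

end Capacities

/-- The channel is reversely strongly degraded:
`W(y,y₁|x,s) = W_{Y|X,S}(y|x,s)·W_{Y₁|Y}(y₁|y)`. -/
def RevStronglyDegraded {𝒳 𝒮 𝒴 𝒴₁ : Type} [Fintype 𝒴] [Fintype 𝒴₁]
    (W : 𝒳 → 𝒮 → 𝒴 × 𝒴₁ → ℝ) : Prop :=
  ∃ (WY : 𝒳 → 𝒮 → 𝒴 → ℝ) (V : 𝒴 → 𝒴₁ → ℝ),
    (∀ x s, IsPMF (WY x s)) ∧ (∀ y, IsPMF (V y)) ∧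
    ∀ x s y y1, W x s (y, y1) = WY x s y * V y y1

/-- A state-dependent DMC `V(z|x,s)` is symmetrizable. -/
def Symmetrizable {𝒳 𝒮 𝒵 : Type} [Fintype 𝒮] (V : 𝒳 → 𝒮 → 𝒵 → ℝ) : Prop :=
  ∃ J : 𝒳 → 𝒮 → ℝ, (∀ x, IsPMF (J x)) ∧
    ∀ x x' z, (∑ s, V x s z * J x' s) = ∑ s, V x' s z * J x s

/-- The real-valued indicator of a proposition. -/
def ind (p : Prop) : ℝ := open Classical in if p then 1 else 0

theorem ind_pos {p : Prop} (h : p) : ind p = 1 := if_pos h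

theorem ind_neg {p : Prop} (h : ¬ p) : ind p = 0 := if_neg h

theorem ind_nonneg (p : Prop) : 0 ≤ ind p := by
  unfold ind; split_ifs <;> simp

theorem sum_pi_prod_eq {ι α : Type} [Fintype ι] [DecidableEq ι] [Fintype α]
    (w : ι → α → ℝ) : ∑ ω : ι → α, ∏ k, w k (ω k) = ∏ k, ∑ a, w k a := by
  rw [Finset.prod_univ_sum, Fintype.piFinset_univ]

theorem sum_pi_prod_eq_one {ι α : Type} [Fintype ι] [DecidableEq ι] [Fintype α]
    (w : ι → α → ℝ) (hw : ∀ i, ∑ a, w i a = 1) : ∑ ω : ι → α, ∏ k, w k (ω k) = 1 := by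
  rw [sum_pi_prod_eq]; simp [hw]

theorem isPMF_pi {ι α : Type} [Fintype ι] [DecidableEq ι] [Fintype α]
    (w : ι → α → ℝ) (hw : ∀ i, IsPMF (w i)) : IsPMF (fun ω : ι → α => ∏ k, w k (ω k)) :=
  ⟨fun _ => Finset.prod_nonneg fun _ _ => (hw _).1 _,
    sum_pi_prod_eq_one w fun i => (hw i).2⟩

/-- Marginal expectation of one coordinate under a product weight. -/
theorem sum_pi_marginal {ι α : Type} [Fintype ι] [DecidableEq ι] [Fintype α]
    (w : ι → α → ℝ) (hw : ∀ i, ∑ a, w i a = 1) (i : ι) (f : α → ℝ) :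
    ∑ ω : ι → α, (∏ k, w k (ω k)) * f (ω i) = ∑ a, w i a * f a := by
  have h1 : ∀ ω : ι → α, (∏ k, w k (ω k)) * f (ω i)
      = ∏ k, (w k (ω k) * if k = i then f (ω k) else 1) := fun ω => by
    rw [Finset.prod_mul_distrib, Finset.prod_ite_eq' Finset.univ i (fun k => f (ω k))]
    simp
  simp_rw [h1]
  rw [sum_pi_prod_eq (fun k a => w k a * if k = i then f a else 1)]
  have h2 : ∀ k, ∑ a, (w k a * if k = i then f a else 1)
      = if k = i then ∑ a, w k a * f a else 1 := fun k => by
    split_ifs <;> simp [hw]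
  simp_rw [h2]
  rw [Finset.prod_ite_eq' Finset.univ i (fun k => ∑ a, w k a * f a)]
  simp

/-- Two distinct coordinates are independent under a product weight. -/
theorem sum_pi_marginal_pair {ι α : Type} [Fintype ι] [DecidableEq ι] [Fintype α]
    (w : ι → α → ℝ) (hw : ∀ i, ∑ a, w i a = 1) {i j : ι} (hij : i ≠ j) (f : α → α → ℝ) :
    ∑ ω : ι → α, (∏ k, w k (ω k)) * f (ω i) (ω j)
      = ∑ a, w i a * ∑ b, w j b * f a b := by
  classical
  have h0 : ∀ ω : ι → α, (∏ k, w k (ω k)) * f (ω i) (ω j)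
      = ∑ a, ∏ k, (w k (ω k) * if k = i then (if ω k = a then 1 else 0)
          else if k = j then f a (ω k) else 1) := fun ω => by
    have : ∀ a, ∏ k, (w k (ω k) * if k = i then (if ω k = a then 1 else 0)
          else if k = j then f a (ω k) else 1)
        = if ω i = a then (∏ k, w k (ω k)) * f a (ω j) else 0 := fun a => by
      rw [Finset.prod_mul_distrib]
      have : ∀ k, (if k = i then (if ω k = a then (1 : ℝ) else 0)
          else if k = j then f a (ω k) else 1)
          = (if k = i then (if ω k = a then (1 : ℝ) else 0) else 1) *
            (if k = j then f a (ω k) else 1) := fun k => by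
        by_cases hk : k = i
        · subst hk; simp [hij]
        · simp [hk]
      simp_rw [this]
      rw [Finset.prod_mul_distrib,
        Finset.prod_ite_eq' Finset.univ i (fun k => if ω k = a then (1 : ℝ) else 0),
        Finset.prod_ite_eq' Finset.univ j (fun k => f a (ω k))]
      simp only [Finset.mem_univ, if_true]
      split_ifs <;> simp
    simp_rw [this]
    simp
  simp_rw [h0]
  rw [Finset.sum_comm]
  refine Finset.sum_congr rfl fun a _ => ?_
  rw [sum_pi_prod_eq (fun k b => w k b * if k = i then (if b = a then 1 else 0)
          else if k = j then f a b else 1)]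
  have h2 : ∀ k, ∑ b, (w k b * if k = i then (if b = a then 1 else 0)
          else if k = j then f a b else 1)
      = (if k = i then w k a else 1) * (if k = j then ∑ b, w k b * f a b else 1) := fun k => by
    by_cases hk : k = i
    · subst hk; simp [hij]
    · by_cases hk' : k = j
      · subst hk'; simp [hk]
      · simp [hk, hk', hw]
  simp_rw [h2]
  rw [Finset.prod_mul_distrib, Finset.prod_ite_eq' Finset.univ i (fun k => w k a),
    Finset.prod_ite_eq' Finset.univ j (fun k => ∑ b, w k b * f a b)]
  simp

theorem IsPMF.mixture {α β : Type} [Fintype α] [Fintype β] {q : α → ℝ} (hq : IsPMF q)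
    {P : α → β → ℝ} (hP : ∀ a, IsPMF (P a)) : IsPMF (fun b => ∑ a, q a * P a b) := by
  refine ⟨fun b => Finset.sum_nonneg fun a _ => mul_nonneg (hq.1 a) ((hP a).1 b), ?_⟩
  rw [Finset.sum_comm]
  simp_rw [← Finset.mul_sum, (hP _).2, mul_one, hq.2]

theorem log_two_pos : 0 < Real.log 2 := Real.log_pos one_lt_two

theorem ent_mul_log_two {α : Type} [Fintype α] (p : α → ℝ) :
    ent p * Real.log 2 = -∑ a, p a * Real.log (p a) := by
  have := log_two_pos.ne'
  simp only [ent, Real.logb, neg_mul, Finset.sum_mul]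
  congr 1
  refine Finset.sum_congr rfl fun a _ => ?_
  field_simp

theorem ent_nonneg {α : Type} [Fintype α] {p : α → ℝ} (hp : IsPMF p) : 0 ≤ ent p := by
  refine nonneg_of_mul_nonneg_left ?_ log_two_pos
  rw [ent_mul_log_two, neg_nonneg]
  refine Finset.sum_nonpos fun a _ => mul_nonpos_of_nonneg_of_nonpos (hp.1 a) ?_
  refine Real.log_nonpos (hp.1 a) ?_
  rw [← hp.2]
  exact Finset.single_le_sum (fun b _ => hp.1 b) (Finset.mem_univ a)

theorem ent_le_card_div {α : Type} [Fintype α] {p : α → ℝ} (hp : IsPMF p) :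
    ent p ≤ Fintype.card α / Real.log 2 := by
  rw [le_div_iff₀ log_two_pos, ent_mul_log_two, ← Finset.sum_neg_distrib]
  calc ∑ a, -(p a * Real.log (p a)) ≤ ∑ _a : α, (1 : ℝ) := by
        refine Finset.sum_le_sum fun a _ => ?_
        rcases (hp.1 a).eq_or_lt with h | h
        · simp [← h]
        · have h1 := Real.log_le_sub_one_of_pos (inv_pos.2 h)
          rw [Real.log_inv] at h1
          have h2 := mul_le_mul_of_nonneg_left h1 h.le
          rw [mul_sub, mul_inv_cancel₀ h.ne'] at h2
          linarith
    _ = _ := by simp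

theorem mutInfo_le {α β : Type} [Fintype α] [Fintype β] {p : α × β → ℝ} (hp : IsPMF p) :
    mutInfo p ≤ Fintype.card α / Real.log 2 + Fintype.card β / Real.log 2 := by
  have h1 : IsPMF (fun a => ∑ b, p (a, b)) :=
    ⟨fun a => Finset.sum_nonneg fun b _ => hp.1 _, by rw [← Fintype.sum_prod_type, hp.2]⟩
  have h2 : IsPMF (fun b => ∑ a, p (a, b)) :=
    ⟨fun a => Finset.sum_nonneg fun b _ => hp.1 _, by
      rw [← Fintype.sum_prod_type_right, hp.2]⟩
  have := ent_le_card_div h1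
  have := ent_le_card_div h2
  have := ent_nonneg hp
  unfold mutInfo
  linarith

theorem condMutInfo_mul_log_two {υ α β : Type} [Fintype υ] [Fintype α] [Fintype β]
    (P : υ × α × β → ℝ) :
    condMutInfo P * Real.log 2 = ∑ t, P t * (Real.log (P t)
      + Real.log (∑ a, ∑ b, P (t.1, a, b)) - Real.log (∑ b, P (t.1, t.2.1, b))
      - Real.log (∑ a, P (t.1, a, t.2.2))) := by
  have h : condMutInfo P * Real.log 2
      = ent (fun ua : υ × α => ∑ b, P (ua.1, ua.2, b)) * Real.log 2
        + ent (fun ub : υ × β => ∑ a, P (ub.1, a, ub.2)) * Real.log 2 - ent P * Real.log 2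
        - ent (fun u : υ => ∑ a, ∑ b, P (u, a, b)) * Real.log 2 := by
    unfold condMutInfo; ring
  rw [h]
  simp only [ent_mul_log_two, Fintype.sum_prod_type, mul_sub, mul_add, Finset.sum_sub_distrib,
    Finset.sum_add_distrib, Finset.sum_mul]
  have : ∀ u, ∑ b, ∑ a, P (u, a, b) * Real.log (∑ a, P (u, a, b))
      = ∑ a, ∑ b, P (u, a, b) * Real.log (∑ a, P (u, a, b)) := fun u => Finset.sum_comm
  simp_rw [this]
  ring

theorem mutInfo_eq_condMutInfo {α β : Type} [Fintype α] [Fintype β] {p : α × β → ℝ}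
    (hp : IsPMF p) : mutInfo p = condMutInfo (fun t : Unit × α × β => p t.2) := by
  have h := hp.2
  rw [Fintype.sum_prod_type] at h
  unfold mutInfo condMutInfo ent
  simp [Fintype.sum_prod_type, h]

theorem condMutInfo_nonneg {υ α β : Type} [Fintype υ] [Fintype α] [Fintype β]
    {P : υ × α × β → ℝ} (hP : ∀ t, 0 ≤ P t) : 0 ≤ condMutInfo P := by
  refine nonneg_of_mul_nonneg_left ?_ log_two_pos
  rw [condMutInfo_mul_log_two]
  set PU : υ → ℝ := fun u => ∑ a, ∑ b, P (u, a, b) with hPU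
  set PA : υ → α → ℝ := fun u a => ∑ b, P (u, a, b) with hPA
  set PB : υ → β → ℝ := fun u b => ∑ a, P (u, a, b) with hPB
  have hA : ∀ u a b, P (u, a, b) ≤ PA u a := fun u a b =>
    Finset.single_le_sum (f := fun b => P (u, a, b)) (fun _ _ => hP _) (Finset.mem_univ b)
  have hB : ∀ u a b, P (u, a, b) ≤ PB u b := fun u a b =>
    Finset.single_le_sum (f := fun a => P (u, a, b)) (fun _ _ => hP _) (Finset.mem_univ a)
  have hA0 : ∀ u a, 0 ≤ PA u a := fun u a => Finset.sum_nonneg fun _ _ => hP _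
  have hB0 : ∀ u b, 0 ≤ PB u b := fun u b => Finset.sum_nonneg fun _ _ => hP _
  have hU : ∀ u a, PA u a ≤ PU u := fun u a =>
    Finset.single_le_sum (f := fun a => PA u a) (fun _ _ => hA0 _ _) (Finset.mem_univ a)
  have hU0 : ∀ u, 0 ≤ PU u := fun u => Finset.sum_nonneg fun _ _ => hA0 _ _
  have hBU : ∀ u, ∑ b, PB u b = PU u := fun u => Finset.sum_comm
  have key : ∑ t : υ × α × β, (P t - PA t.1 t.2.1 * PB t.1 t.2.2 / PU t.1) ≤
      ∑ t, P t * (Real.log (P t) + Real.log (PU t.1) - Real.log (PA t.1 t.2.1)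
        - Real.log (PB t.1 t.2.2)) := by
    refine Finset.sum_le_sum fun t _ => ?_
    obtain ⟨u, a, b⟩ := t
    dsimp only
    rcases (hP (u, a, b)).eq_or_lt with h | h
    · rw [← h, zero_mul, zero_sub, neg_nonpos]
      exact div_nonneg (mul_nonneg (hA0 _ _) (hB0 _ _)) (hU0 _)
    · have ha := h.trans_le (hA u a b)
      have hb := h.trans_le (hB u a b)
      have hu := ha.trans_le (hU u a)
      have hx : 0 < PA u a * PB u b / (PU u * P (u, a, b)) := by positivity
      have h1 := Real.log_le_sub_one_of_pos hx
      rw [Real.log_div (by positivity) (by positivity), Real.log_mul ha.ne' hb.ne',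
        Real.log_mul hu.ne' h.ne'] at h1
      have h2 := mul_le_mul_of_nonneg_left h1 h.le
      have h3 : P (u, a, b) * (PA u a * PB u b / (PU u * P (u, a, b)) - 1)
          = PA u a * PB u b / PU u - P (u, a, b) := by field_simp
      rw [h3] at h2
      linarith
  refine le_trans ?_ key
  simp only [Finset.sum_sub_distrib, Fintype.sum_prod_type]
  rw [← Finset.sum_sub_distrib]
  refine Finset.sum_nonneg fun u _ => ?_
  have : ∑ a, ∑ b, PA u a * PB u b / PU u = PU u := by
    simp_rw [← Finset.sum_div, ← Finset.mul_sum, hBU, ← Finset.sum_mul]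
    change PU u * PU u / PU u = PU u
    rcases (hU0 u).eq_or_lt with h | h
    · simp [← h]
    · field_simp
  rw [this]
  simp [hPU]

theorem mutInfo_nonneg {α β : Type} [Fintype α] [Fintype β] {p : α × β → ℝ}
    (hp : IsPMF p) : 0 ≤ mutInfo p := by
  rw [mutInfo_eq_condMutInfo hp]
  exact condMutInfo_nonneg fun t => hp.1 _

/-- A bounded log-likelihood score whose mean under `P` is close to the conditional mutual
information, while its exponential moment under an independent input is at most one. -/
theorem exists_score {υ α β : Type} [Fintype υ] [Fintype α] [Fintype β]
    {P : υ × α × β → ℝ} (hP : IsPMF P) {pU : υ → ℝ} {κ : υ → α → ℝ} (hκ : ∀ u, IsPMF (κ u))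
    (hm : ∀ u a, ∑ b, P (u, a, b) = pU u * κ u a) {δ : ℝ} (hδ : 0 < δ) :
    ∃ φ : υ × α × β → ℝ, (∀ u b, ∑ a, κ u a * Real.exp (φ (u, a, b)) ≤ 1) ∧
      condMutInfo P * Real.log 2 - δ ≤ ∑ t, P t * φ t := by
  classical
  set PB : υ → β → ℝ := fun u b => ∑ a, P (u, a, b) with hPB
  have hPU : ∀ u, ∑ a, ∑ b, P (u, a, b) = pU u := fun u => by
    simp_rw [hm, ← Finset.mul_sum, (hκ u).2, mul_one]
  have hA : ∀ u a b, P (u, a, b) ≤ pU u * κ u a := fun u a b => by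
    rw [← hm]
    exact Finset.single_le_sum (f := fun b => P (u, a, b)) (fun _ _ => hP.1 _) (Finset.mem_univ b)
  have hB : ∀ u a b, P (u, a, b) ≤ PB u b := fun u a b =>
    Finset.single_le_sum (f := fun a => P (u, a, b)) (fun _ _ => hP.1 _) (Finset.mem_univ a)
  have hB0 : ∀ u b, 0 ≤ PB u b := fun u b => Finset.sum_nonneg fun _ _ => hP.1 _
  have hU0 : ∀ u, 0 ≤ pU u := fun u => by
    rw [← hPU]; exact Finset.sum_nonneg fun _ _ => Finset.sum_nonneg fun _ _ => hP.1 _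
  have h1δ : 0 < 1 + δ := by linarith
  let ψ : υ × α × β → ℝ := fun t => Real.log (P t) + Real.log (pU t.1)
    - Real.log (pU t.1 * κ t.1 t.2.1) - Real.log (PB t.1 t.2.2)
  refine ⟨fun t => (if 0 < P t then ψ t else Real.log δ) - Real.log (1 + δ), fun u b => ?_, ?_⟩
  · have hterm : ∀ a, κ u a * Real.exp ((if 0 < P (u, a, b) then ψ (u, a, b) else Real.log δ)
        - Real.log (1 + δ)) ≤ (P (u, a, b) / PB u b + κ u a * δ) / (1 + δ) := fun a => by
      rw [Real.exp_sub, Real.exp_log h1δ, mul_div_assoc']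
      refine div_le_div_of_nonneg_right ?_ h1δ.le
      split_ifs with h
      · have ha := h.trans_le (hA u a b)
        have hb := h.trans_le (hB u a b)
        have hu : 0 < pU u := lt_of_le_of_ne (hU0 u) fun h0 => by simp [← h0] at ha
        have hk : 0 < κ u a := lt_of_le_of_ne ((hκ u).1 a) fun h0 => by simp [← h0] at ha
        have : Real.exp (ψ (u, a, b)) = P (u, a, b) * pU u / (pU u * κ u a) / PB u b := by
          simp only [ψ]
          rw [Real.exp_sub, Real.exp_sub, Real.exp_add, Real.exp_log h, Real.exp_log hu,
            Real.exp_log ha, Real.exp_log hb]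
        rw [this]
        have h2 : κ u a * (P (u, a, b) * pU u / (pU u * κ u a) / PB u b)
            = P (u, a, b) / PB u b := by field_simp
        rw [h2]
        have := mul_nonneg hk.le hδ.le
        linarith
      · rw [Real.exp_log hδ]
        have := div_nonneg (hP.1 (u, a, b)) (hB0 u b)
        linarith
    refine (Finset.sum_le_sum fun a _ => hterm a).trans ?_
    rw [← Finset.sum_div, Finset.sum_add_distrib, ← Finset.sum_div, ← Finset.sum_mul, (hκ u).2,
      div_le_one h1δ]
    have : (∑ a, P (u, a, b)) / PB u b ≤ 1 := div_self_le_one _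
    linarith
  · have hmain : ∑ t, P t * ((if 0 < P t then ψ t else Real.log δ) - Real.log (1 + δ))
        = condMutInfo P * Real.log 2 - Real.log (1 + δ) := by
      rw [condMutInfo_mul_log_two]
      simp_rw [mul_sub, Finset.sum_sub_distrib]
      rw [← Finset.sum_mul, hP.2, one_mul]
      congr 1
      simp_rw [← Finset.sum_sub_distrib]
      refine Finset.sum_congr rfl fun t _ => ?_
      split_ifs with h
      · simp only [ψ, hPB]; rw [hPU, hm]; ring
      · have : P t = 0 := le_antisymm (not_lt.1 h) (hP.1 t)
        simp [this]
    rw [hmain]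
    have := Real.log_le_sub_one_of_pos h1δ
    linarith

/-- Exponential concentration for sums of independent bounded scores. -/
theorem chernoff_lower {B δ : ℝ} (hB : 0 < B) (hδ : 0 < δ) : ∃ c > 0,
    ∀ {ζ 𝒮 : Type} [Fintype ζ] (P : 𝒮 → ζ → ℝ), (∀ s, IsPMF (P s)) →
    ∀ φ : ζ → ℝ, (∀ z, |φ z| ≤ B) → ∀ (n : ℕ) (s : Fin n → 𝒮) (T : ℝ),
      n * (T + δ) ≤ ∑ i, ∑ z, P (s i) z * φ z →
      ∑ z : Fin n → ζ, (if ∑ i, φ (z i) < n * T then ∏ i, P (s i) (z i) else 0)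
        ≤ Real.exp (-(n * c)) := by
  set lam : ℝ := min (1 / B) (δ / (2 * B ^ 2)) with hlam
  have hl0 : 0 < lam := by positivity
  have hl1 : lam * B ≤ 1 := by
    rw [← le_div_iff₀ hB]; exact min_le_left _ _
  have hl2 : lam * B ^ 2 ≤ δ / 2 := by
    have : lam ≤ δ / (2 * B ^ 2) := min_le_right _ _
    calc lam * B ^ 2 ≤ δ / (2 * B ^ 2) * B ^ 2 := by gcongr
      _ = δ / 2 := by field_simp
  refine ⟨lam * δ / 2, by positivity, ?_⟩
  intro ζ 𝒮 _ P hP φ hφ n s T hT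
  have hstep : ∀ z : Fin n → ζ, (if ∑ i, φ (z i) < n * T then ∏ i, P (s i) (z i) else 0)
      ≤ Real.exp (lam * (n * T)) * ∏ i, (P (s i) (z i) * Real.exp (-(lam * φ (z i)))) :=
    fun z => by
    have h0 : 0 ≤ ∏ i, P (s i) (z i) := Finset.prod_nonneg fun i _ => (hP _).1 _
    rw [Finset.prod_mul_distrib, ← Real.exp_sum, Finset.sum_neg_distrib, ← Finset.mul_sum,
      mul_left_comm, ← Real.exp_add]
    split_ifs with h
    · refine le_mul_of_one_le_right h0 (Real.one_le_exp ?_)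
      nlinarith
    · positivity
  refine (Finset.sum_le_sum fun z _ => hstep z).trans ?_
  rw [← Finset.mul_sum, sum_pi_prod_eq (fun i a => P (s i) a * Real.exp (-(lam * φ a)))]
  have hfac : ∀ i, ∑ a, P (s i) a * Real.exp (-(lam * φ a))
      ≤ Real.exp (-(lam * ∑ a, P (s i) a * φ a) + lam ^ 2 * B ^ 2) := fun i => by
    have hpt : ∀ a, Real.exp (-(lam * φ a)) ≤ 1 - lam * φ a + lam ^ 2 * B ^ 2 := fun a => by
      have hx : |-(lam * φ a)| ≤ lam * B := by
        rw [abs_neg, abs_mul, abs_of_pos hl0]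
        exact mul_le_mul_of_nonneg_left (hφ a) hl0.le
      have h1 := Real.abs_exp_sub_one_sub_id_le (hx.trans hl1)
      have h2 := (le_abs_self _).trans h1
      have h3 : (-(lam * φ a)) ^ 2 ≤ (lam * B) ^ 2 := sq_le_sq' (by linarith [(abs_le.1 hx).1])
        (abs_le.1 hx).2
      nlinarith
    calc ∑ a, P (s i) a * Real.exp (-(lam * φ a))
        ≤ ∑ a, P (s i) a * (1 - lam * φ a + lam ^ 2 * B ^ 2) :=
          Finset.sum_le_sum fun a _ => mul_le_mul_of_nonneg_left (hpt a) ((hP _).1 a)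
      _ = -(lam * ∑ a, P (s i) a * φ a) + lam ^ 2 * B ^ 2 + 1 := by
          have : ∀ a, P (s i) a * (1 - lam * φ a + lam ^ 2 * B ^ 2)
            = P (s i) a * (1 + lam ^ 2 * B ^ 2) - lam * (P (s i) a * φ a) := fun a => by ring
          simp_rw [this, Finset.sum_sub_distrib, ← Finset.sum_mul, ← Finset.mul_sum, (hP _).2]
          ring
      _ ≤ _ := Real.add_one_le_exp _
  calc Real.exp (lam * (n * T)) * ∏ i, ∑ a, P (s i) a * Real.exp (-(lam * φ a))
      ≤ Real.exp (lam * (n * T)) *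
        ∏ i, Real.exp (-(lam * ∑ a, P (s i) a * φ a) + lam ^ 2 * B ^ 2) := by
        refine mul_le_mul_of_nonneg_left (Finset.prod_le_prod (fun i _ => ?_) fun i _ => hfac i)
          (Real.exp_pos _).le
        exact Finset.sum_nonneg fun a _ => mul_nonneg ((hP _).1 a) (Real.exp_pos _).le
    _ = Real.exp (lam * (n * T) + (-(lam * ∑ i, ∑ a, P (s i) a * φ a)
          + n * (lam ^ 2 * B ^ 2))) := by
        rw [← Real.exp_sum, ← Real.exp_add, Finset.sum_add_distrib, Finset.sum_neg_distrib,
          ← Finset.mul_sum]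
        simp
    _ ≤ _ := by
        refine Real.exp_le_exp.2 ?_
        have h1 := mul_le_mul_of_nonneg_left hT hl0.le
        have h2 : (n : ℝ) * (lam ^ 2 * B ^ 2) ≤ n * (lam * (δ / 2)) := by
          refine mul_le_mul_of_nonneg_left ?_ (Nat.cast_nonneg n)
          nlinarith
        linarith

/-- The empirical distribution of a finite family. -/
theorem exists_empirical {ι 𝒮 : Type} [Fintype ι] [Nonempty ι] [Fintype 𝒮] (s : ι → 𝒮) :
    ∃ q : 𝒮 → ℝ, IsPMF q ∧
      ∀ f : 𝒮 → ℝ, (Fintype.card ι : ℝ) * ∑ a, q a * f a = ∑ i, f (s i) := by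
  classical
  set n : ℝ := (Fintype.card ι : ℝ) with hn
  have hn' : n ≠ 0 := by rw [hn]; exact_mod_cast Fintype.card_ne_zero
  have key : ∀ f : 𝒮 → ℝ, n * ∑ a, (n⁻¹ * ∑ i, if s i = a then 1 else 0) * f a
      = ∑ i, f (s i) := fun f => by
    simp_rw [mul_assoc, ← Finset.mul_sum, Finset.sum_mul]
    rw [mul_inv_cancel_left₀ hn', Finset.sum_comm]
    simp
  refine ⟨fun a => n⁻¹ * ∑ i, if s i = a then 1 else 0, ⟨fun a => ?_, ?_⟩, key⟩
  · exact mul_nonneg (by positivity) (Finset.sum_nonneg fun i _ => by split_ifs <;> simp)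
  · have := key fun _ => 1
    simp only [mul_one, Finset.sum_const, Finset.card_univ, nsmul_eq_mul] at this
    exact mul_left_cancel₀ hn' (by rw [this, mul_one])

/-- A universal block test: it accepts the truly transmitted sequence with probability
exponentially close to one for every state sequence, and accepts an independent one with
probability at most `K * exp (-n T)`. -/
theorem exists_universal_test {ζ υ α β 𝒮 : Type} [Fintype ζ] [Fintype υ] [Fintype α] [Fintype β]
    [Fintype 𝒮] {P : 𝒮 → ζ → ℝ} (hP : ∀ s, IsPMF (P s)) {pU : υ → ℝ} {κ : υ → α → ℝ}
    (hκ : ∀ u, IsPMF (κ u)) {D : 𝒮 → υ × α × β → ℝ} (hD : ∀ s t, 0 ≤ D s t)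
    (hDm : ∀ s u a, ∑ b, D s (u, a, b) = pU u * κ u a) (proj : ζ → υ × α × β)
    (hproj : ∀ s (φ : υ × α × β → ℝ), ∑ z, P s z * φ (proj z) = ∑ t, D s t * φ t) {T I : ℝ}
    (hTI : T < I)
    (hI : ∀ q, IsPMF q → I ≤ condMutInfo (fun t => ∑ s, q s * D s t) * Real.log 2) :
    ∃ c > 0, ∃ K ≥ 0, ∀ n ≥ 1, ∃ test : (Fin n → υ) → (Fin n → α) → (Fin n → β) → Prop,
      (∀ u y, ∑ x : Fin n → α, (∏ i, κ (u i) (x i)) * ind (test u x y) ≤ K * Real.exp (-(n * T))) ∧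
      ∀ s : Fin n → 𝒮, ∑ z : Fin n → ζ, (∏ i, P (s i) (z i)) *
        ind (¬ test (fun i => (proj (z i)).1) (fun i => (proj (z i)).2.1)
          (fun i => (proj (z i)).2.2)) ≤ Real.exp (-(n * c)) := by
  classical
  have hDs : ∀ s, IsPMF (D s) := fun s => ⟨hD s, by
    have := hproj s fun _ => 1
    simp only [mul_one, (hP s).2] at this
    exact this.symm⟩
  obtain ⟨δ, hδ, hδI⟩ : ∃ δ > 0, T + 3 * δ ≤ I := ⟨(I - T) / 3, by linarith, by linarith⟩
  have hsc : ∀ q : {q : 𝒮 → ℝ // IsPMF q}, ∃ φ : υ × α × β → ℝ,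
      (∀ u b, ∑ a, κ u a * Real.exp (φ (u, a, b)) ≤ 1) ∧
      I - δ ≤ ∑ s, q.1 s * ∑ t, D s t * φ t := by
    rintro ⟨q, hq⟩
    obtain ⟨φ, h1, h2⟩ := exists_score (hq.mixture hDs) (pU := pU) hκ (fun u a => by
      rw [Finset.sum_comm]
      simp_rw [← Finset.mul_sum, hDm, ← Finset.sum_mul, hq.2, one_mul]) hδ
    refine ⟨φ, h1, ?_⟩
    have h3 := hI q hq
    have h4 : ∑ t, (∑ s, q s * D s t) * φ t = ∑ s, q s * ∑ t, D s t * φ t := by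
      simp_rw [Finset.sum_mul, Finset.mul_sum]
      rw [Finset.sum_comm]
      simp_rw [mul_assoc]
    linarith
  choose φ hφ1 hφ2 using hsc
  have hcomp : IsCompact {q : 𝒮 → ℝ | IsPMF q} := isCompact_stdSimplex ℝ 𝒮
  obtain ⟨F, hF⟩ := hcomp.elim_finite_subcover
    (fun r : {q : 𝒮 → ℝ // IsPMF q} => {q : 𝒮 → ℝ | I - 2 * δ < ∑ s, q s * ∑ t, D s t * φ r t})
    (fun r => isOpen_lt continuous_const (by fun_prop))
    (fun q hq => Set.mem_iUnion.2 ⟨⟨q, hq⟩, by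
      have := hφ2 ⟨q, hq⟩
      simp only [Set.mem_ofPred_eq] at this ⊢
      linarith⟩)
  set B : ℝ := 1 + ∑ r ∈ F, ∑ t, |φ r t| with hB
  have hB0 : 0 < B := by positivity
  have hBφ : ∀ r ∈ F, ∀ t, |φ r t| ≤ B := fun r hr t => by
    have h1 : |φ r t| ≤ ∑ t, |φ r t| :=
      Finset.single_le_sum (f := fun t => |φ r t|) (fun _ _ => abs_nonneg _) (Finset.mem_univ t)
    have h2 : ∑ t, |φ r t| ≤ ∑ r ∈ F, ∑ t, |φ r t| :=
      Finset.single_le_sum (f := fun r => ∑ t, |φ r t|)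
        (fun _ _ => Finset.sum_nonneg fun _ _ => abs_nonneg _) hr
    linarith
  obtain ⟨c, hc, hch⟩ := chernoff_lower hB0 hδ
  refine ⟨c, hc, F.card, by positivity, fun n hn => ⟨fun u x y =>
    ∃ r ∈ F, n * T ≤ ∑ i, φ r (u i, x i, y i), fun u y => ?_, fun s => ?_⟩⟩
  · have hstep : ∀ x : Fin n → α, (∏ i, κ (u i) (x i)) *
        ind (∃ r ∈ F, n * T ≤ ∑ i, φ r (u i, x i, y i))
        ≤ ∑ r ∈ F, Real.exp (-(n * T)) *
          ∏ i, (κ (u i) (x i) * Real.exp (φ r (u i, x i, y i))) := fun x => by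
      have h0 : 0 ≤ ∏ i, κ (u i) (x i) := Finset.prod_nonneg fun i _ => (hκ _).1 _
      have hn0 : ∀ r, 0 ≤ Real.exp (-(n * T)) *
          ∏ i, (κ (u i) (x i) * Real.exp (φ r (u i, x i, y i))) := fun r =>
        mul_nonneg (Real.exp_pos _).le
          (Finset.prod_nonneg fun i _ => mul_nonneg ((hκ _).1 _) (Real.exp_pos _).le)
      by_cases h : ∃ r ∈ F, n * T ≤ ∑ i, φ r (u i, x i, y i)
      · rw [ind_pos h, mul_one]
        obtain ⟨r, hr, hle⟩ := h
        refine le_trans ?_ (Finset.single_le_sum (fun r _ => hn0 r) hr)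
        rw [Finset.prod_mul_distrib, ← Real.exp_sum, mul_left_comm, ← Real.exp_add]
        refine le_mul_of_one_le_right h0 (Real.one_le_exp ?_)
        linarith
      · rw [ind_neg h, mul_zero]
        exact Finset.sum_nonneg fun r _ => hn0 r
    refine (Finset.sum_le_sum fun x _ => hstep x).trans ?_
    rw [Finset.sum_comm]
    refine (Finset.sum_le_card_nsmul _ _ (Real.exp (-(n * T))) fun r _ => ?_).trans_eq
      (nsmul_eq_mul _ _)
    rw [← Finset.mul_sum,
      sum_pi_prod_eq (fun i a => κ (u i) a * Real.exp (φ r (u i, a, y i)))]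
    refine mul_le_of_le_one_right (Real.exp_pos _).le (Finset.prod_le_one (fun i _ => ?_)
      fun i _ => hφ1 r _ _)
    exact Finset.sum_nonneg fun a _ => mul_nonneg ((hκ _).1 _) (Real.exp_pos _).le
  · have : Nonempty (Fin n) := ⟨⟨0, hn⟩⟩
    obtain ⟨q, hq, hqs⟩ := exists_empirical s
    rw [Fintype.card_fin] at hqs
    obtain ⟨r, hr, hlt⟩ : ∃ r ∈ F, I - 2 * δ < ∑ s, q s * ∑ t, D s t * φ r t := by
      have := hF hq
      simpa only [Set.mem_iUnion, Set.mem_ofPred_eq, exists_prop] using this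
    have hmean : n * (T + δ) ≤ ∑ i, ∑ z, P (s i) z * φ r (proj z) := by
      simp_rw [hproj]
      rw [← hqs fun s => ∑ t, D s t * φ r t]
      exact mul_le_mul_of_nonneg_left (by linarith) (Nat.cast_nonneg n)
    refine le_trans (Finset.sum_le_sum fun z _ => ?_)
      (hch P hP (fun z => φ r (proj z)) (fun z => hBφ r hr _) n s T hmean)
    have h0 : 0 ≤ ∏ i, P (s i) (z i) := Finset.prod_nonneg fun i _ => (hP _).1 _
    by_cases h : ∃ r ∈ F, n * T ≤ ∑ i, φ r (proj (z i))
    · rw [ind_neg (not_not.2 h), mul_zero]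
      split_ifs
      · exact h0
      · exact le_rfl
    · rw [ind_pos h, mul_one, if_pos]
      by_contra h'
      exact h ⟨r, hr, not_lt.1 h'⟩

theorem not_of_ind_lt_one {p : Prop} (h : ind p < 1) : ¬ p := fun hp => by
  rw [ind_pos hp] at h; exact lt_irrefl _ h

theorem epsilon_eq_of_unique {ι : Type} [Nonempty ι] {T : ι → Prop} {i : ι} (hi : T i)
    (h : ∀ j, j ≠ i → ¬ T j) : Classical.epsilon T = i := by
  by_contra hne
  exact h _ hne (Classical.epsilon_spec ⟨i, hi⟩)

/-- Superposition random coding for one block with a relay: the relay decodes the cloud centre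
`(l, b)` and forwards `l`; the receiver then decodes `b` and finally the satellite index `c`. -/
theorem exists_random_block_code {𝒰 𝒜 𝒪 𝒪₁ : Type} [Fintype 𝒰] [Fintype 𝒜] [Fintype 𝒪]
    [Fintype 𝒪₁] (L B K : ℕ) [NeZero L] [NeZero B] [NeZero K]
    {wU : 𝒰 → ℝ} (hwU : IsPMF wU) {wX : 𝒰 → 𝒜 → ℝ} (hwX : ∀ u, IsPMF (wX u))
    (t1 : 𝒰 → 𝒪₁ → Prop) (t0 : 𝒰 → 𝒪 → Prop) (t2 : 𝒰 → 𝒜 → 𝒪 → Prop) {η1 η0 η2 : ℝ}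
    (h1 : ∀ y1, ∑ u, wU u * ind (t1 u y1) ≤ η1) (h0 : ∀ y, ∑ u, wU u * ind (t0 u y) ≤ η0)
    (h2 : ∀ u y, ∑ x, wX u x * ind (t2 u x y) ≤ η2) :
    ∃ (J : Type) (_ : Fintype J) (pr : J → ℝ), IsPMF pr ∧
      ∃ (f : J → Fin L × Fin B × Fin K → 𝒜) (f1 : J → 𝒪₁ → Fin L)
        (g : J → 𝒪 × Fin L → Fin L × Fin B × Fin K),
      ∀ V : 𝒜 → 𝒪 × 𝒪₁ → ℝ, (∀ x, IsPMF (V x)) → ∀ m,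
        ∑ j, pr j * ∑ y, ∑ y1, (if g j (y, f1 j y1) = m then 0 else V (f j m) (y, y1)) ≤
          ∑ u, wU u * ∑ x, wX u x * ∑ o, V x o *
            (ind (¬ t1 u o.2) + ind (¬ t0 u o.1) + ind (¬ t2 u x o.1))
          + (L * B - 1) * η1 + (B - 1) * η0 + (K - 1) * η2 := by
  classical
  let Ω := 𝒰 × (Fin K → 𝒜)
  let w : Ω → ℝ := fun a => wU a.1 * ∏ c, wX a.1 (a.2 c)
  have hsat : ∀ u, IsPMF (fun xs : Fin K → 𝒜 => ∏ c, wX u (xs c)) := fun u =>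
    isPMF_pi (fun _ => wX u) fun _ => hwX u
  have hw : IsPMF w := by
    refine ⟨fun a => mul_nonneg (hwU.1 _) ((hsat _).1 _), ?_⟩
    simp only [w, Ω, Fintype.sum_prod_type, ← Finset.mul_sum, (hsat _).2, mul_one, hwU.2]
  let J := Fin L × Fin B → Ω
  let pr : J → ℝ := fun ω => ∏ k, w (ω k)
  have hpr : IsPMF pr := isPMF_pi (fun _ => w) fun _ => hw
  let f : J → Fin L × Fin B × Fin K → 𝒜 := fun ω m => (ω (m.1, m.2.1)).2 m.2.2
  let f1 : J → 𝒪₁ → Fin L := fun ω y1 => (Classical.epsilon fun k => t1 (ω k).1 y1).1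
  let gb : J → 𝒪 × Fin L → Fin B := fun ω o =>
    Classical.epsilon fun b => t0 (ω (o.2, b)).1 o.1
  let gc : J → 𝒪 × Fin L → Fin B → Fin K := fun ω o b =>
    Classical.epsilon fun c => t2 (ω (o.2, b)).1 ((ω (o.2, b)).2 c) o.1
  let g : J → 𝒪 × Fin L → Fin L × Fin B × Fin K := fun ω o => (o.2, gb ω o, gc ω o (gb ω o))
  refine ⟨J, inferInstance, pr, hpr, f, f1, g, fun V hV => ?_⟩
  rintro ⟨l, b, c⟩
  -- expectation of a function of one cloud and one of its satellites
  have hEw : ∀ h : 𝒰 → 𝒜 → ℝ,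
      ∑ a : Ω, w a * h a.1 (a.2 c) = ∑ u, wU u * ∑ x, wX u x * h u x := fun h => by
    simp only [w, Ω, Fintype.sum_prod_type, mul_assoc, ← Finset.mul_sum]
    refine Finset.sum_congr rfl fun u _ => ?_
    rw [sum_pi_marginal (fun _ => wX u) (fun _ => (hwX u).2) c (h u)]
  have hE1 : ∀ h : 𝒰 → ℝ, ∑ a : Ω, w a * h a.1 = ∑ u, wU u * h u := fun h => by
    rw [hEw fun u _ => h u]
    simp_rw [← Finset.sum_mul, (hwX _).2, one_mul]
  let A : Ω → ℝ := fun a => ∑ o, V (a.2 c) o *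
    (ind (¬ t1 a.1 o.2) + ind (¬ t0 a.1 o.1) + ind (¬ t2 a.1 (a.2 c) o.1))
  let E1 : Ω → Ω → ℝ := fun a a' => ∑ o, V (a.2 c) o * ind (t1 a'.1 o.2)
  let E0 : Ω → Ω → ℝ := fun a a' => ∑ o, V (a.2 c) o * ind (t0 a'.1 o.1)
  let E2 : Fin K → Ω → ℝ := fun c' a => ∑ o, V (a.2 c) o * ind (t2 a.1 (a.2 c') o.1)
  have hpoint : ∀ ω : J,
      ∑ y, ∑ y1, (if g ω (y, f1 ω y1) = (l, b, c) then 0 else V (f ω (l, b, c)) (y, y1))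
      ≤ A (ω (l, b)) + ∑ k ∈ Finset.univ.erase (l, b), E1 (ω (l, b)) (ω k)
        + ∑ b' ∈ Finset.univ.erase b, E0 (ω (l, b)) (ω (l, b'))
        + ∑ c' ∈ Finset.univ.erase c, E2 c' (ω (l, b)) := fun ω => by
    rw [← Fintype.sum_prod_type fun o : 𝒪 × 𝒪₁ =>
      if g ω (o.1, f1 ω o.2) = (l, b, c) then 0 else V (f ω (l, b, c)) o]
    simp only [A, E1, E0, E2]
    rw [Finset.sum_comm (s := Finset.univ.erase (l, b)),
      Finset.sum_comm (s := Finset.univ.erase b), Finset.sum_comm (s := Finset.univ.erase c)]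
    simp_rw [← Finset.mul_sum, ← Finset.sum_add_distrib, ← mul_add]
    refine Finset.sum_le_sum fun o _ => ?_
    have hVo : 0 ≤ V (f ω (l, b, c)) o := (hV _).1 _
    have hn1 := ind_nonneg (¬ t1 (ω (l, b)).1 o.2)
    have hn0 := ind_nonneg (¬ t0 (ω (l, b)).1 o.1)
    have hn2 := ind_nonneg (¬ t2 (ω (l, b)).1 ((ω (l, b)).2 c) o.1)
    have hs1 : 0 ≤ ∑ k ∈ Finset.univ.erase (l, b), ind (t1 (ω k).1 o.2) :=
      Finset.sum_nonneg fun _ _ => ind_nonneg _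
    have hs0 : 0 ≤ ∑ b' ∈ Finset.univ.erase b, ind (t0 (ω (l, b')).1 o.1) :=
      Finset.sum_nonneg fun _ _ => ind_nonneg _
    have hs2 : 0 ≤ ∑ c' ∈ Finset.univ.erase c, ind (t2 (ω (l, b)).1 ((ω (l, b)).2 c') o.1) :=
      Finset.sum_nonneg fun _ _ => ind_nonneg _
    split_ifs with hg
    · exact mul_nonneg hVo (by linarith)
    · refine le_mul_of_one_le_right hVo ?_
      by_contra hlt
      rw [not_le] at hlt
      apply hg
      have k1 : t1 (ω (l, b)).1 o.2 :=
        not_not.1 (not_of_ind_lt_one (by linarith))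
      have k0 : t0 (ω (l, b)).1 o.1 :=
        not_not.1 (not_of_ind_lt_one (by linarith))
      have k2 : t2 (ω (l, b)).1 ((ω (l, b)).2 c) o.1 :=
        not_not.1 (not_of_ind_lt_one (by linarith))
      have r1 : ∀ k, k ≠ (l, b) → ¬ t1 (ω k).1 o.2 := fun k hk => by
        have := Finset.single_le_sum (f := fun k => ind (t1 (ω k).1 o.2))
          (fun _ _ => ind_nonneg _) (Finset.mem_erase.2 ⟨hk, Finset.mem_univ k⟩)
        exact not_of_ind_lt_one (by linarith)
      have r0 : ∀ b', b' ≠ b → ¬ t0 (ω (l, b')).1 o.1 := fun b' hb' => by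
        have := Finset.single_le_sum (f := fun b' => ind (t0 (ω (l, b')).1 o.1))
          (fun _ _ => ind_nonneg _) (Finset.mem_erase.2 ⟨hb', Finset.mem_univ b'⟩)
        exact not_of_ind_lt_one (by linarith)
      have r2 : ∀ c', c' ≠ c → ¬ t2 (ω (l, b)).1 ((ω (l, b)).2 c') o.1 := fun c' hc' => by
        have := Finset.single_le_sum
          (f := fun c' => ind (t2 (ω (l, b)).1 ((ω (l, b)).2 c') o.1))
          (fun _ _ => ind_nonneg _) (Finset.mem_erase.2 ⟨hc', Finset.mem_univ c'⟩)
        exact not_of_ind_lt_one (by linarith)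
      have d1 : f1 ω o.2 = l :=
        congrArg Prod.fst (epsilon_eq_of_unique (T := fun k => t1 (ω k).1 o.2) k1 r1)
      have d0 : gb ω (o.1, l) = b :=
        epsilon_eq_of_unique (T := fun b => t0 (ω (l, b)).1 o.1) k0 r0
      have d2 : gc ω (o.1, l) b = c :=
        epsilon_eq_of_unique (T := fun c => t2 (ω (l, b)).1 ((ω (l, b)).2 c) o.1) k2 r2
      simp only [g, d1, d0, d2]
  have hmean : ∑ a, w a * A a = ∑ u, wU u * ∑ x, wX u x * ∑ o, V x o *
      (ind (¬ t1 u o.2) + ind (¬ t0 u o.1) + ind (¬ t2 u x o.1)) :=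
    hEw fun u x => ∑ o, V x o * (ind (¬ t1 u o.2) + ind (¬ t0 u o.1) + ind (¬ t2 u x o.1))
  have hpair : ∀ (h : 𝒰 → 𝒪 × 𝒪₁ → ℝ) (η : ℝ), (∀ o, ∑ u, wU u * h u o ≤ η) →
      ∀ k, k ≠ (l, b) →
        ∑ ω : J, pr ω * ∑ o, V ((ω (l, b)).2 c) o * h (ω k).1 o ≤ η := fun h η hh k hk => by
    rw [sum_pi_marginal_pair (fun _ : Fin L × Fin B => w) (fun _ => hw.2) (Ne.symm hk)
      (fun a a' => ∑ o, V (a.2 c) o * h a'.1 o)]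
    calc ∑ a, w a * ∑ a', w a' * ∑ o, V (a.2 c) o * h a'.1 o
        = ∑ a, w a * ∑ o, V (a.2 c) o * ∑ u, wU u * h u o := by
          refine Finset.sum_congr rfl fun a _ => ?_
          congr 1
          simp_rw [← hE1 fun u => h u _, Finset.mul_sum]
          rw [Finset.sum_comm]
          refine Finset.sum_congr rfl fun o _ => Finset.sum_congr rfl fun a' _ => ?_
          ring
      _ ≤ ∑ a, w a * ∑ o, V (a.2 c) o * η := by
          refine Finset.sum_le_sum fun a _ => mul_le_mul_of_nonneg_left ?_ (hw.1 a)
          exact Finset.sum_le_sum fun o _ => mul_le_mul_of_nonneg_left (hh o) ((hV _).1 _)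
      _ = η := by simp_rw [← Finset.sum_mul, (hV _).2, one_mul, ← Finset.sum_mul, hw.2, one_mul]
  have hsat2 : ∀ c', c' ≠ c → ∑ ω : J, pr ω * E2 c' (ω (l, b)) ≤ η2 := fun c' hc' => by
    rw [sum_pi_marginal (fun _ : Fin L × Fin B => w) (fun _ => hw.2) (l, b) (E2 c')]
    simp only [w, Ω, E2, Fintype.sum_prod_type, mul_assoc, ← Finset.mul_sum]
    refine (Finset.sum_le_sum fun u _ => mul_le_mul_of_nonneg_left ?_ (hwU.1 u)).trans_eq
      (b := ∑ u, wU u * η2) (by rw [← Finset.sum_mul, hwU.2, one_mul])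
    rw [sum_pi_marginal_pair (fun _ => wX u) (fun _ => (hwX u).2) (Ne.symm hc')
      (fun x x' => ∑ y, ∑ y1, V x (y, y1) * ind (t2 u x' y))]
    calc ∑ x, wX u x * ∑ x', wX u x' * ∑ y, ∑ y1, V x (y, y1) * ind (t2 u x' y)
        = ∑ x, wX u x * ∑ y, ∑ y1, V x (y, y1) * ∑ x', wX u x' * ind (t2 u x' y) := by
          refine Finset.sum_congr rfl fun x _ => ?_
          congr 1
          simp_rw [Finset.mul_sum]
          rw [Finset.sum_comm]
          refine Finset.sum_congr rfl fun y _ => ?_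
          rw [Finset.sum_comm]
          refine Finset.sum_congr rfl fun y1 _ => Finset.sum_congr rfl fun x' _ => ?_
          ring
      _ ≤ ∑ x, wX u x * ∑ y, ∑ y1, V x (y, y1) * η2 := by
          refine Finset.sum_le_sum fun x _ => mul_le_mul_of_nonneg_left ?_ ((hwX u).1 x)
          exact Finset.sum_le_sum fun y _ => Finset.sum_le_sum fun y1 _ =>
            mul_le_mul_of_nonneg_left (h2 u y) ((hV _).1 _)
      _ = η2 := by
          have hV1 : ∀ x, ∑ y, ∑ y1, V x (y, y1) = 1 := fun x => by
            rw [← Fintype.sum_prod_type, (hV x).2]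
          simp_rw [← Finset.sum_mul, hV1, one_mul, ← Finset.sum_mul, (hwX u).2, one_mul]
  refine (Finset.sum_le_sum fun ω _ =>
    mul_le_mul_of_nonneg_left (hpoint ω) (hpr.1 ω)).trans ?_
  rw [← hmean]
  simp only [mul_add, Finset.sum_add_distrib, Finset.mul_sum (s := Finset.univ.erase _)]
  rw [Finset.sum_comm (t := Finset.univ.erase (l, b)),
    Finset.sum_comm (t := Finset.univ.erase b), Finset.sum_comm (t := Finset.univ.erase c)]
  have b0 : ∑ ω : J, pr ω * A (ω (l, b)) = ∑ a, w a * A a :=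
    (sum_pi_marginal (fun _ : Fin L × Fin B => w) (fun _ => hw.2) (l, b) A)
  rw [b0]
  have hL : 1 ≤ L * B := Nat.mul_pos (NeZero.pos L) (NeZero.pos B)
  have b1 : ∑ k ∈ Finset.univ.erase (l, b), ∑ ω : J, pr ω * E1 (ω (l, b)) (ω k)
      ≤ (L * B - 1) * η1 := by
    refine (Finset.sum_le_card_nsmul _ _ η1 fun k hk =>
      hpair (fun u o => ind (t1 u o.2)) η1 (fun o => h1 _) k (Finset.ne_of_mem_erase hk)).trans_eq ?_
    rw [Finset.card_erase_of_mem (Finset.mem_univ _), Finset.card_univ, nsmul_eq_mul]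
    simp [Nat.cast_sub hL]
  have b2 : ∑ b' ∈ Finset.univ.erase b, ∑ ω : J, pr ω * E0 (ω (l, b)) (ω (l, b'))
      ≤ (B - 1) * η0 := by
    refine (Finset.sum_le_card_nsmul _ _ η0 fun k hk =>
      hpair (fun u o => ind (t0 u o.1)) η0 (fun o => h0 _) (l, k) (fun he =>
        Finset.ne_of_mem_erase hk (congrArg Prod.snd he))).trans_eq ?_
    rw [Finset.card_erase_of_mem (Finset.mem_univ _), Finset.card_univ, nsmul_eq_mul]
    simp [Nat.cast_sub (NeZero.pos B)]
  have b3 : ∑ c' ∈ Finset.univ.erase c, ∑ ω : J, pr ω * E2 c' (ω (l, b))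
      ≤ (K - 1) * η2 := by
    refine (Finset.sum_le_card_nsmul _ _ η2 fun k hk =>
      hsat2 k (Finset.ne_of_mem_erase hk)).trans_eq ?_
    rw [Finset.card_erase_of_mem (Finset.mem_univ _), Finset.card_univ, nsmul_eq_mul]
    simp [Nat.cast_sub (NeZero.pos K)]
  linarith

theorem isPMF_joint {α β : Type} [Fintype α] [Fintype β] {p : α → ℝ} (hp : IsPMF p)
    {V : α → β → ℝ} (hV : ∀ a, IsPMF (V a)) : IsPMF (fun t : α × β => p t.1 * V t.1 t.2) := by
  refine ⟨fun t => mul_nonneg (hp.1 _) ((hV _).1 _), ?_⟩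
  simp only [Fintype.sum_prod_type, ← Finset.mul_sum, (hV _).2, mul_one, hp.2]

theorem mutInfo_channel_mul_log_two {α β : Type} [Fintype α] [Fintype β] {p : α → ℝ}
    (hp : IsPMF p) {V : α → β → ℝ} (hV : ∀ a, IsPMF (V a)) :
    mutInfo (fun t : α × β => p t.1 * V t.1 t.2) * Real.log 2
      = ∑ a, p a * ∑ b, V a b * (Real.log (V a b) - Real.log (∑ a, p a * V a b)) := by
  rw [mutInfo_eq_condMutInfo (isPMF_joint hp hV), condMutInfo_mul_log_two]
  simp only [Fintype.sum_prod_type, ← Finset.mul_sum, (hV _).2, mul_one, hp.2, Real.log_one,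
    Finset.univ_unique, Finset.sum_singleton, add_zero]
  simp_rw [Finset.mul_sum]
  refine Finset.sum_congr rfl fun a _ => Finset.sum_congr rfl fun b _ => ?_
  by_cases ha : p a = 0
  · simp [ha]
  by_cases hb : V a b = 0
  · simp [hb]
  rw [Real.log_mul ha hb]
  ring

/-- Weak converse for list decoding over a memoryless channel. -/
theorem list_code_converse {𝒳 𝒵 : Type} [Fintype 𝒳] [Fintype 𝒵] {V : 𝒳 → 𝒵 → ℝ}
    (hV : ∀ x, IsPMF (V x)) {n M K : ℕ} (hn : 1 ≤ n) (hM : 1 ≤ M) (hK : 1 ≤ K)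
    (f : Fin M → Fin n → 𝒳) {p : 𝒳 → ℝ} (hp : IsPMF p)
    (hpf : ∀ h : 𝒳 → ℝ, (M * n : ℝ) * ∑ x, p x * h x = ∑ m, ∑ i, h (f m i))
    (A : Fin M → (Fin n → 𝒵) → Prop) (hA : ∀ z, ∑ m, ind (A m z) ≤ K) {ε : ℝ} (hε : ε ≤ 1)
    (hsucc : M * (1 - ε) ≤ ∑ m, ∑ z : Fin n → 𝒵, (∏ i, V (f m i) (z i)) * ind (A m z)) :
    (1 - ε) * (Real.log M - Real.log K) ≤
      n * (mutInfo (fun t : 𝒳 × 𝒵 => p t.1 * V t.1 t.2) * Real.log 2) + Real.log 2 := by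
  classical
  have hM0 : (0 : ℝ) < M := by exact_mod_cast hM
  have hK0 : (0 : ℝ) < K := by exact_mod_cast hK
  have hn0 : (0 : ℝ) < n := by exact_mod_cast hn
  have hI0 := mul_nonneg (mutInfo_nonneg (isPMF_joint hp hV)) log_two_pos.le
  rcases le_total (Real.log M - Real.log K) 0 with ht | ht
  · have := mul_nonpos_of_nonneg_of_nonpos (sub_nonneg.2 hε) ht
    have := mul_nonneg hn0.le hI0
    have := log_two_pos
    linarith
  set t := Real.log M - Real.log K with htdef
  have hexp : Real.exp t = M / K := by
    rw [htdef, Real.exp_sub, Real.exp_log hM0, Real.exp_log hK0]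
  set Q : 𝒵 → ℝ := fun z => ∑ x, p x * V x z with hQdef
  have hQ : IsPMF Q := hp.mixture hV
  have hpos : ∀ m i, 0 < p (f m i) := fun m i => by
    have h1 := hpf fun x => if x = f m i then 1 else 0
    simp only [mul_ite, mul_one, mul_zero, Finset.sum_ite_eq', Finset.mem_univ, if_true] at h1
    have h2 : (1 : ℝ) ≤ ∑ m', ∑ i', if f m' i' = f m i then 1 else 0 := by
      have e1 := Finset.single_le_sum (f := fun i' => if f m i' = f m i then (1 : ℝ) else 0)
        (fun _ _ => by positivity) (Finset.mem_univ i)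
      have e2 := Finset.single_le_sum
        (f := fun m' => ∑ i', if f m' i' = f m i then (1 : ℝ) else 0)
        (fun _ _ => Finset.sum_nonneg fun _ _ => by positivity) (Finset.mem_univ m)
      simp only [if_true] at e1
      exact e1.trans e2
    rw [← h1] at h2
    exact pos_of_mul_pos_right (zero_lt_one.trans_le h2) (by positivity)
  have hQpos : ∀ m i z, 0 < V (f m i) z → 0 < Q z := fun m i z hz =>
    (mul_pos (hpos m i) hz).trans_le (Finset.single_le_sum (f := fun x => p x * V x z)
      (fun x _ => mul_nonneg (hp.1 x) ((hV x).1 z)) (Finset.mem_univ (f m i)))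
  let ℓ : 𝒳 → 𝒵 → ℝ := fun x z => Real.log (V x z) - Real.log (Q z)
  have hpt : ∀ m (z : Fin n → 𝒵), (∏ i, V (f m i) (z i)) * (t * ind (A m z))
      - (∏ i, V (f m i) (z i)) * ∑ i, ℓ (f m i) (z i)
      ≤ (∏ i, V (f m i) (z i)) * (Real.log 2 - 1)
        + (∏ i, Q (z i)) * (1 + M / K * ind (A m z)) / 2 := fun m z => by
    set Pz := ∏ i, V (f m i) (z i) with hPz
    set Qz := ∏ i, Q (z i) with hQz
    have hQ0 : 0 ≤ Qz := Finset.prod_nonneg fun i _ => hQ.1 _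
    have hP0 : 0 ≤ Pz := Finset.prod_nonneg fun i _ => (hV _).1 _
    have hind := ind_nonneg (A m z)
    have he : Real.exp (t * ind (A m z)) ≤ 1 + M / K * ind (A m z) := by
      by_cases h : A m z
      · rw [ind_pos h, mul_one, mul_one, hexp]; linarith
      · simp [ind_neg h]
    have hbound := mul_le_mul_of_nonneg_left he hQ0
    rcases hP0.eq_or_lt with h | h
    · rw [← h]
      have := (mul_nonneg hQ0 (Real.exp_pos (t * ind (A m z))).le).trans hbound
      linarith
    · have hVi : ∀ i, 0 < V (f m i) (z i) := fun i =>
        lt_of_le_of_ne ((hV _).1 _) fun h0 => by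
          rw [hPz, Finset.prod_eq_zero (Finset.mem_univ i) h0.symm] at h
          exact lt_irrefl _ h
      have hQi : ∀ i, 0 < Q (z i) := fun i => hQpos m i _ (hVi i)
      have hQz0 : 0 < Qz := Finset.prod_pos fun i _ => hQi i
      have hx : 0 < Qz * Real.exp (t * ind (A m z)) / (2 * Pz) := by positivity
      have h1 := Real.log_le_sub_one_of_pos hx
      rw [Real.log_div (by positivity) (by positivity), Real.log_mul hQz0.ne' (by positivity),
        Real.log_exp, Real.log_mul two_ne_zero h.ne'] at h1
      have hl : ∑ i, ℓ (f m i) (z i) = Real.log Pz - Real.log Qz := by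
        rw [hPz, hQz, Real.log_prod fun i _ => (hVi i).ne', Real.log_prod fun i _ => (hQi i).ne',
          ← Finset.sum_sub_distrib]
      have h2 := mul_le_mul_of_nonneg_left h1 h.le
      have h3 : Pz * (Qz * Real.exp (t * ind (A m z)) / (2 * Pz) - 1)
          = Qz * Real.exp (t * ind (A m z)) / 2 - Pz := by field_simp
      rw [h3] at h2
      rw [hl]
      linarith
  have hsum := Finset.sum_le_sum fun m (_ : m ∈ Finset.univ) =>
    Finset.sum_le_sum fun z (_ : z ∈ Finset.univ) => hpt m z
  have hPone : ∀ m, ∑ z : Fin n → 𝒵, ∏ i, V (f m i) (z i) = 1 := fun m =>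
    sum_pi_prod_eq_one (fun i => V (f m i)) fun i => (hV _).2
  have hQone : ∑ z : Fin n → 𝒵, ∏ i, Q (z i) = 1 :=
    sum_pi_prod_eq_one (fun _ => Q) fun i => hQ.2
  have hl1 : ∑ m, ∑ z : Fin n → 𝒵, (∏ i, V (f m i) (z i)) * (t * ind (A m z))
      = t * ∑ m, ∑ z : Fin n → 𝒵, (∏ i, V (f m i) (z i)) * ind (A m z) := by
    simp_rw [Finset.mul_sum]
    refine Finset.sum_congr rfl fun m _ => Finset.sum_congr rfl fun z _ => ?_
    ring
  have hl2 : ∑ m, ∑ z : Fin n → 𝒵, (∏ i, V (f m i) (z i)) * ∑ i, ℓ (f m i) (z i)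
      = M * n * (mutInfo (fun t : 𝒳 × 𝒵 => p t.1 * V t.1 t.2) * Real.log 2) := by
    rw [mutInfo_channel_mul_log_two hp hV, hpf fun x => ∑ z, V x z * ℓ x z]
    refine Finset.sum_congr rfl fun m _ => ?_
    simp_rw [Finset.mul_sum]
    rw [Finset.sum_comm]
    exact Finset.sum_congr rfl fun i _ =>
      sum_pi_marginal (fun i => V (f m i)) (fun i => (hV _).2) i (ℓ (f m i))
  have hr2 : ∑ m, ∑ z : Fin n → 𝒵, (∏ i, Q (z i)) * (1 + M / K * ind (A m z)) / 2 ≤ M := by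
    have : ∑ m, ∑ z : Fin n → 𝒵, (∏ i, Q (z i)) * (1 + M / K * ind (A m z)) / 2
        = (∑ z : Fin n → 𝒵, (∏ i, Q (z i)) * (M + M / K * ∑ m, ind (A m z))) / 2 := by
      rw [Finset.sum_comm, Finset.sum_div]
      refine Finset.sum_congr rfl fun z _ => ?_
      rw [← Finset.sum_div, ← Finset.mul_sum, Finset.sum_add_distrib, ← Finset.mul_sum]
      simp
    rw [this]
    have h2 : ∑ z : Fin n → 𝒵, (∏ i, Q (z i)) * (M + M / K * ∑ m, ind (A m z))
        ≤ ∑ z : Fin n → 𝒵, (∏ i, Q (z i)) * (M + M / K * K) :=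
      Finset.sum_le_sum fun z _ => mul_le_mul_of_nonneg_left
        (by gcongr; exact hA z) (Finset.prod_nonneg fun i _ => hQ.1 _)
    rw [← Finset.sum_mul, hQone, div_mul_cancel₀ _ hK0.ne'] at h2
    linarith
  simp only [Finset.sum_sub_distrib, Finset.sum_add_distrib] at hsum
  rw [hl1, hl2] at hsum
  simp_rw [← Finset.sum_mul, hPone] at hsum
  simp only [Finset.sum_const, Finset.card_univ, Fintype.card_fin, nsmul_eq_mul] at hsum
  have h5 := mul_le_mul_of_nonneg_left hsucc ht
  refine le_of_mul_le_mul_left ?_ hM0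
  linarith

theorem sum_arrow_prod {ι α β : Type} [Fintype ι] [DecidableEq ι] [Fintype α] [Fintype β]
    (F : (ι → α) → (ι → β) → ℝ) :
    ∑ z : ι → α × β, F (fun i => (z i).1) (fun i => (z i).2) = ∑ a, ∑ b, F a b := by
  rw [← Fintype.sum_prod_type']
  exact Fintype.sum_equiv (Equiv.arrowProdEquivProdArrow ι (fun _ => α) (fun _ => β)) _ _
    fun z => rfl

theorem PMF.exists_le_of_tsum_le {J : Type} (π : PMF J) (e : J → ℝ) {ε ε' : ℝ} (hε : 0 < ε)
    (hlt : ε < ε') (h : ∑' j, π j * ENNReal.ofReal (e j) ≤ ENNReal.ofReal ε) :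
    ∃ j, e j ≤ ε' := by
  by_contra! hcon
  have h1 : ∑' j, π j * ENNReal.ofReal ε' ≤ ∑' j, π j * ENNReal.ofReal (e j) :=
    ENNReal.tsum_le_tsum fun j => by gcongr; exact (hcon j).le
  rw [ENNReal.tsum_mul_right, π.tsum_coe, one_mul] at h1
  have h2 := (ENNReal.ofReal_le_ofReal_iff hε.le).1 (h1.trans h)
  linarith

section Converse

variable {𝒳 𝒮 𝒴 𝒴₁ : Type} [Fintype 𝒮] [Fintype 𝒴] [Fintype 𝒴₁]

theorem isPMF_averaged {W : 𝒳 → 𝒮 → 𝒴 × 𝒴₁ → ℝ} (hW : IsChannel W) {q : 𝒮 → ℝ}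
    (hq : IsPMF q) (x : 𝒳) : IsPMF (fun z => ∑ s, q s * W x s z) :=
  hq.mixture fun s => hW x s

theorem isPMF_averaged_fst {W : 𝒳 → 𝒮 → 𝒴 × 𝒴₁ → ℝ} (hW : IsChannel W) {q : 𝒮 → ℝ}
    (hq : IsPMF q) (x : 𝒳) : IsPMF (fun y => ∑ s, q s * ∑ y1, W x s (y, y1)) :=
  hq.mixture fun s => ⟨fun _ => Finset.sum_nonneg fun _ _ => (hW x s).1 _, by
    rw [← Fintype.sum_prod_type, (hW x s).2]⟩

theorem errJoint_iid {W : 𝒳 → 𝒮 → 𝒴 × 𝒴₁ → ℝ} {n M L : ℕ} (C : PCode 𝒳 𝒴 𝒴₁ n M L)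
    (q : 𝒮 → ℝ) : C.errJoint W (fun s => ∏ i, q (s i)) = (M : ℝ)⁻¹ * ∑ m, ∑ y, ∑ y1,
      if C.g (y, C.f1 y1) = m then 0 else ∏ i, ∑ s, q s * W (C.f m i) s (y i, y1 i) := by
  have h : ∀ m y y1, (if C.g (y, C.f1 y1) = m then (0 : ℝ)
      else ∏ i, ∑ s, q s * W (C.f m i) s (y i, y1 i))
      = ∑ s : Fin n → 𝒮, (∏ i, q (s i)) * (if C.g (y, C.f1 y1) = m then 0
        else ∏ i, W (C.f m i) (s i) (y i, y1 i)) := fun m y y1 => by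
    split_ifs
    · simp
    · rw [← sum_pi_prod_eq (fun i s => q s * W (C.f m i) s (y i, y1 i))]
      simp_rw [Finset.prod_mul_distrib]
  simp_rw [h]
  unfold PCode.errJoint PCode.errGiven
  simp_rw [Finset.mul_sum]
  rw [Finset.sum_comm]
  refine Finset.sum_congr rfl fun m _ => ?_
  rw [Finset.sum_comm]
  refine Finset.sum_congr rfl fun y _ => ?_
  rw [Finset.sum_comm]
  refine Finset.sum_congr rfl fun y1 _ => Finset.sum_congr rfl fun s _ => ?_
  ring

/-- The cutset bound at finite block length for a deterministic code. -/
theorem cutset_finite_block [Fintype 𝒳] {W : 𝒳 → 𝒮 → 𝒴 × 𝒴₁ → ℝ} (hW : IsChannel W) {q : 𝒮 → ℝ}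
    (hq : IsPMF q) {C1 : ℝ} {n M L : ℕ} (hn : 1 ≤ n) (hM : 1 ≤ M) (hL : LinkOK n L C1)
    (C : PCode 𝒳 𝒴 𝒴₁ n M L) {ε : ℝ} (hε0 : 0 ≤ ε) (hε : ε ≤ 1)
    (herr : C.errJoint W (fun s => ∏ i, q (s i)) ≤ ε) :
    ∃ p : 𝒳 → ℝ, IsPMF p ∧ (1 - ε) * Real.log M
      ≤ (n * min (IqXY W p q + C1) (IqXYY1 W p q) + 1) * Real.log 2 := by
  classical
  have hM0 : (0 : ℝ) < M := by exact_mod_cast hM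
  set V : 𝒳 → 𝒴 × 𝒴₁ → ℝ := fun x z => ∑ s, q s * W x s z with hVdef
  set V' : 𝒳 → 𝒴 → ℝ := fun x y => ∑ s, q s * ∑ y1, W x s (y, y1) with hVdef'
  have hV : ∀ x, IsPMF (V x) := fun x => isPMF_averaged hW hq x
  have hV' : ∀ x, IsPMF (V' x) := fun x => isPMF_averaged_fst hW hq x
  have hmarg : ∀ x y, V' x y = ∑ y1, V x (y, y1) := fun x y => by
    simp only [hVdef, hVdef', Finset.mul_sum]
    exact Finset.sum_comm
  have hne : Nonempty (Fin M × Fin n) := ⟨(⟨0, hM⟩, ⟨0, hn⟩)⟩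
  obtain ⟨p, hp, hpf⟩ := exists_empirical fun k : Fin M × Fin n => C.f k.1 k.2
  have hpf' : ∀ h : 𝒳 → ℝ, (M * n : ℝ) * ∑ x, p x * h x = ∑ m, ∑ i, h (C.f m i) := fun h => by
    rw [← Fintype.sum_prod_type fun k : Fin M × Fin n => h (C.f k.1 k.2), ← hpf h]
    simp
  refine ⟨p, hp, ?_⟩
  have htotal : ∀ m, ∑ y : Fin n → 𝒴, ∑ y1 : Fin n → 𝒴₁, ∏ i, V (C.f m i) (y i, y1 i) = 1 :=
    fun m => by
    rw [← sum_arrow_prod fun (y : Fin n → 𝒴) (y1 : Fin n → 𝒴₁) => ∏ i, V (C.f m i) (y i, y1 i)]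
    exact sum_pi_prod_eq_one (fun i => V (C.f m i)) fun i => (hV _).2
  have hs : M * (1 - ε) ≤ ∑ m, ∑ y : Fin n → 𝒴, ∑ y1 : Fin n → 𝒴₁,
      (∏ i, V (C.f m i) (y i, y1 i)) * ind (C.g (y, C.f1 y1) = m) := by
    rw [errJoint_iid, inv_mul_le_iff₀ hM0] at herr
    have hsplit : ∀ m, ∑ y : Fin n → 𝒴, ∑ y1 : Fin n → 𝒴₁,
        (∏ i, V (C.f m i) (y i, y1 i)) * ind (C.g (y, C.f1 y1) = m)
        = 1 - ∑ y : Fin n → 𝒴, ∑ y1 : Fin n → 𝒴₁,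
          if C.g (y, C.f1 y1) = m then 0 else ∏ i, V (C.f m i) (y i, y1 i) := fun m => by
      rw [← htotal m]
      simp_rw [← Finset.sum_sub_distrib]
      refine Finset.sum_congr rfl fun y _ => Finset.sum_congr rfl fun y1 _ => ?_
      by_cases h : C.g (y, C.f1 y1) = m
      · simp [h, ind_pos]
      · simp [h, ind_neg]
    simp_rw [hsplit, Finset.sum_sub_distrib]
    simp only [Finset.sum_const, Finset.card_univ, Fintype.card_fin, nsmul_eq_mul]
    linarith
  have hind : ∀ a : Fin M, ∑ m, ind (a = m) = 1 := fun a => by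
    rw [Finset.sum_eq_single a (fun m _ h => ind_neg h.symm) (by simp), ind_pos rfl]
  have c2 := list_code_converse hV hn hM le_rfl C.f hp hpf'
    (fun m z => C.g (fun i => (z i).1, C.f1 fun i => (z i).2) = m)
    (fun z => by rw [hind]; simp) hε (hs.trans_eq (Finset.sum_congr rfl fun m _ =>
      (sum_arrow_prod fun y y1 =>
        (∏ i, V (C.f m i) (y i, y1 i)) * ind (C.g (y, C.f1 y1) = m)).symm))
  have c1 := list_code_converse hV' hn hM hL.1 C.f hp hpf'
    (fun m y => ∃ l, C.g (y, l) = m) (fun y => by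
      calc ∑ m, ind (∃ l, C.g (y, l) = m) ≤ ∑ m, ∑ l, ind (C.g (y, l) = m) := by
            refine Finset.sum_le_sum fun m _ => ?_
            by_cases h : ∃ l, C.g (y, l) = m
            · obtain ⟨l, hl⟩ := h
              rw [ind_pos ⟨l, hl⟩, ← ind_pos hl]
              exact Finset.single_le_sum (f := fun l => ind (C.g (y, l) = m))
                (fun _ _ => ind_nonneg _) (Finset.mem_univ l)
            · rw [ind_neg h]
              exact Finset.sum_nonneg fun _ _ => ind_nonneg _
        _ = L := by rw [Finset.sum_comm]; simp [hind]) hε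
    (hs.trans (Finset.sum_le_sum fun m _ => Finset.sum_le_sum fun y _ => by
      simp_rw [hmarg]
      rw [← sum_pi_prod_eq (fun i y1 => V (C.f m i) (y i, y1)), Finset.sum_mul]
      refine Finset.sum_le_sum fun y1 _ => mul_le_mul_of_nonneg_left ?_
        (Finset.prod_nonneg fun i _ => (hV _).1 _)
      by_cases h : C.g (y, C.f1 y1) = m
      · rw [ind_pos h, ind_pos ⟨_, h⟩]
      · rw [ind_neg h]; exact ind_nonneg _))
  have hL1 : (1 : ℝ) ≤ L := by exact_mod_cast hL.1
  have hlogL : Real.log L ≤ n * C1 * Real.log 2 := by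
    rw [← Real.log_rpow two_pos]
    exact Real.log_le_log (by linarith) hL.2
  have hlogL0 : 0 ≤ Real.log L := Real.log_nonneg hL1
  change _ ≤ (n : ℝ) * (IqXY W p q * Real.log 2) + _ at c1
  change _ ≤ (n : ℝ) * (IqXYY1 W p q * Real.log 2) + _ at c2
  simp only [Nat.cast_one, Real.log_one, sub_zero] at c2
  rcases min_choice (IqXY W p q + C1) (IqXYY1 W p q) with h | h <;> rw [h]
  · nlinarith [mul_nonneg hε0 hlogL0]
  · linarith

/-- The single-state cutset bound on every rate achievable by random codes. -/
theorem AVRCRandAchievable.le_cutset [Fintype 𝒳] {W : 𝒳 → 𝒮 → 𝒴 × 𝒴₁ → ℝ} (hW : IsChannel W) {C1 R : ℝ}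
    (h : AVRCRandAchievable W C1 R) {q : 𝒮 → ℝ} (hq : IsPMF q) :
    R ≤ sSup {v | ∃ p : 𝒳 → ℝ, IsPMF p ∧ v = min (IqXY W p q + C1) (IqXYY1 W p q)} := by
  set S := {v | ∃ p : 𝒳 → ℝ, IsPMF p ∧ v = min (IqXY W p q + C1) (IqXYY1 W p q)} with hS
  have hbdd : BddAbove S := by
    refine ⟨Fintype.card 𝒳 / Real.log 2 + Fintype.card (𝒴 × 𝒴₁) / Real.log 2, ?_⟩
    rintro v ⟨p, hp, rfl⟩
    exact (min_le_right _ _).trans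
      (mutInfo_le (isPMF_joint hp fun x => isPMF_averaged hW hq x))
  refine le_of_forall_pos_le_add fun δ hδ => ?_
  set ε := min 1 (δ / (2 * (|R| + 1))) with hεdef
  have hε0 : 0 < ε := by positivity
  have hε1 : ε ≤ 1 := min_le_left _ _
  have hεR : ε * R ≤ δ / 2 := by
    have h1 : ε ≤ δ / (2 * (|R| + 1)) := min_le_right _ _
    rw [le_div_iff₀ (by positivity)] at h1
    have h2 := mul_le_mul_of_nonneg_left (le_abs_self R) hε0.le
    linarith
  obtain ⟨N, hN⟩ := h (ε / 2) (by positivity)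
  obtain ⟨k, hk⟩ := exists_nat_gt (2 / δ)
  set n := max (max N 1) k with hndef
  have hn1 : 1 ≤ n := (le_max_right N 1).trans (le_max_left _ _)
  obtain ⟨M, L, hRM, hL, J, π, Cs, hJ⟩ := hN n ((le_max_left N 1).trans (le_max_left _ _))
  have hqn := isPMF_pi (fun _ : Fin n => q) fun _ => hq
  obtain ⟨j, hj⟩ := PMF.exists_le_of_tsum_le π _ (by positivity)
    (by linarith : ε / 2 < ε) (hJ _ hqn)
  have hM0 : (0 : ℝ) < M := (Real.rpow_pos_of_pos two_pos _).trans_le hRM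
  have hM : 1 ≤ M := by exact_mod_cast hM0
  obtain ⟨p, hp, hcut⟩ := cutset_finite_block hW hq hn1 hM hL (Cs j) hε0.le hε1 hj
  have hle : min (IqXY W p q + C1) (IqXYY1 W p q) ≤ sSup S := le_csSup hbdd ⟨p, hp, rfl⟩
  have hlogM : n * R * Real.log 2 ≤ Real.log M := by
    rw [← Real.log_rpow two_pos]
    exact Real.log_le_log (Real.rpow_pos_of_pos two_pos _) hRM
  have hn0 : (0 : ℝ) < n := by exact_mod_cast hn1
  have hnδ : 1 ≤ n * (δ / 2) := by
    have : (k : ℝ) ≤ n := by exact_mod_cast le_max_right _ _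
    have h2 : 2 / δ < n := hk.trans_le this
    rw [div_lt_iff₀ hδ] at h2
    linarith
  have h1 := (mul_le_mul_of_nonneg_left hlogM (sub_nonneg.2 hε1)).trans hcut
  have h2 : (1 - ε) * (n * R) ≤ n * min (IqXY W p q + C1) (IqXYY1 W p q) + 1 := by
    refine le_of_mul_le_mul_right ?_ log_two_pos
    linarith
  have h3 := mul_le_mul_of_nonneg_left hle hn0.le
  have h4 := mul_le_mul_of_nonneg_left hεR hn0.le
  refine le_of_mul_le_mul_left ?_ hn0
  linarith

end Converse

theorem IsPMF.exists_factor {υ α : Type} [Fintype υ] [Fintype α] [Nonempty α]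
    {p : υ × α → ℝ} (hp : IsPMF p) :
    ∃ (pU : υ → ℝ) (κ : υ → α → ℝ), IsPMF pU ∧ (∀ u, IsPMF (κ u)) ∧
      ∀ u a, p (u, a) = pU u * κ u a := by
  classical
  have hpU0 : ∀ u, 0 ≤ ∑ a, p (u, a) := fun u => Finset.sum_nonneg fun _ _ => hp.1 _
  refine ⟨fun u => ∑ a, p (u, a), fun u => if ∑ a, p (u, a) = 0
    then Pi.single (Classical.arbitrary α) 1 else fun a => p (u, a) / ∑ a, p (u, a),
    ⟨hpU0, by rw [← Fintype.sum_prod_type, hp.2]⟩, fun u => ?_, fun u a => ?_⟩ <;> dsimp only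
  · split_ifs with h
    · exact ⟨fun a => by by_cases ha : a = Classical.arbitrary α <;> simp [ha],
        by simp [Pi.single_apply]⟩
    · exact ⟨fun a => div_nonneg (hp.1 _) (hpU0 u), by rw [← Finset.sum_div, div_self h]⟩
  · split_ifs with h
    · rw [h, zero_mul]
      exact (Finset.sum_eq_zero_iff_of_nonneg fun _ _ => hp.1 _).1 h a (Finset.mem_univ a)
    · rw [mul_div_cancel₀ _ h]

section Achievability

variable {𝒳 𝒮 𝒴 𝒴₁ : Type} [Fintype 𝒳] [Fintype 𝒴] [Fintype 𝒴₁]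

theorem sum_block_superposition {n k : ℕ} (pU : Fin k → ℝ) (κ : Fin k → 𝒳 → ℝ)
    (W : 𝒳 → 𝒮 → 𝒴 × 𝒴₁ → ℝ) (s : Fin n → 𝒮)
    (F : (Fin n → Fin k) → (Fin n → 𝒳) → (Fin n → 𝒴) → (Fin n → 𝒴₁) → ℝ) :
    ∑ z : Fin n → Fin k × 𝒳 × 𝒴 × 𝒴₁,
      (∏ i, pU (z i).1 * (κ (z i).1 (z i).2.1 * W (z i).2.1 (s i) (z i).2.2)) *
        F (fun i => (z i).1) (fun i => (z i).2.1) (fun i => (z i).2.2.1) (fun i => (z i).2.2.2)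
    = ∑ u : Fin n → Fin k, (∏ i, pU (u i)) * ∑ x : Fin n → 𝒳, (∏ i, κ (u i) (x i)) *
      ∑ o : (Fin n → 𝒴) × (Fin n → 𝒴₁), (∏ i, W (x i) (s i) (o.1 i, o.2 i)) * F u x o.1 o.2 := by
  rw [sum_arrow_prod fun (u : Fin n → Fin k) (w : Fin n → 𝒳 × 𝒴 × 𝒴₁) =>
    (∏ i, pU (u i) * (κ (u i) (w i).1 * W (w i).1 (s i) (w i).2)) *
      F u (fun i => (w i).1) (fun i => (w i).2.1) (fun i => (w i).2.2)]
  refine Finset.sum_congr rfl fun u _ => ?_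
  rw [sum_arrow_prod fun (x : Fin n → 𝒳) (o : Fin n → 𝒴 × 𝒴₁) =>
    (∏ i, pU (u i) * (κ (u i) (x i) * W (x i) (s i) (o i))) *
      F u x (fun i => (o i).1) (fun i => (o i).2), Finset.mul_sum]
  refine Finset.sum_congr rfl fun x _ => ?_
  rw [sum_arrow_prod fun (y : Fin n → 𝒴) (y1 : Fin n → 𝒴₁) =>
    (∏ i, pU (u i) * (κ (u i) (x i) * W (x i) (s i) (y i, y1 i))) * F u x y y1,
    Fintype.sum_prod_type, Finset.mul_sum, Finset.mul_sum]
  refine Finset.sum_congr rfl fun y _ => ?_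
  rw [Finset.mul_sum, Finset.mul_sum]
  refine Finset.sum_congr rfl fun y1 _ => ?_
  simp only [Finset.prod_mul_distrib]
  ring

variable [Fintype 𝒮]

/-- The three joint decoding tests of superposition coding, valid for every state sequence. -/
theorem exists_block_tests {W : 𝒳 → 𝒮 → 𝒴 × 𝒴₁ → ℝ} (hW : IsChannel W) {k : ℕ}
    {p : Fin k × 𝒳 → ℝ} {pU : Fin k → ℝ} {κ : Fin k → 𝒳 → ℝ} (hpU : IsPMF pU)
    (hκ : ∀ u, IsPMF (κ u)) (hp : ∀ u x, p (u, x) = pU u * κ u x) {T1 T0 T2 I1 I0 I2 : ℝ}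
    (hT1 : T1 < I1) (hT0 : T0 < I0) (hT2 : T2 < I2)
    (hI1 : ∀ q, IsPMF q → I1 ≤ IqUY1 W p q * Real.log 2)
    (hI0 : ∀ q, IsPMF q → I0 ≤ IqUY W p q * Real.log 2)
    (hI2 : ∀ q, IsPMF q → I2 ≤ IqXYgivenU W p q * Real.log 2) :
    ∃ c > 0, ∃ K ≥ 0, ∀ n ≥ 1, ∃ (t1 : (Fin n → Fin k) → (Fin n → 𝒴₁) → Prop)
      (t0 : (Fin n → Fin k) → (Fin n → 𝒴) → Prop)
      (t2 : (Fin n → Fin k) → (Fin n → 𝒳) → (Fin n → 𝒴) → Prop),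
      (∀ y1, ∑ u, (∏ i, pU (u i)) * ind (t1 u y1) ≤ K * Real.exp (-(n * T1))) ∧
      (∀ y, ∑ u, (∏ i, pU (u i)) * ind (t0 u y) ≤ K * Real.exp (-(n * T0))) ∧
      (∀ u y, ∑ x, (∏ i, κ (u i) (x i)) * ind (t2 u x y) ≤ K * Real.exp (-(n * T2))) ∧
      ∀ s : Fin n → 𝒮, ∑ u, (∏ i, pU (u i)) * ∑ x, (∏ i, κ (u i) (x i)) *
        ∑ o : (Fin n → 𝒴) × (Fin n → 𝒴₁), (∏ i, W (x i) (s i) (o.1 i, o.2 i)) *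
          (ind (¬ t1 u o.2) + ind (¬ t0 u o.1) + ind (¬ t2 u x o.1))
        ≤ 3 * Real.exp (-(n * c)) := by
  let P : 𝒮 → Fin k × 𝒳 × 𝒴 × 𝒴₁ → ℝ := fun s z =>
    pU z.1 * (κ z.1 z.2.1 * W z.2.1 s z.2.2)
  have hP : ∀ s, IsPMF (P s) := fun s =>
    ⟨fun z => mul_nonneg (hpU.1 _) (mul_nonneg ((hκ _).1 _) ((hW _ _).1 _)), by
      simp only [P, Fintype.sum_prod_type (α₁ := Fin k), Fintype.sum_prod_type (α₁ := 𝒳),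
        ← Finset.mul_sum, (hW _ _).2, mul_one, (hκ _).2, hpU.2]⟩
  have hp0 : ∀ u x s o, 0 ≤ p (u, x) * W x s o := fun u x s o => by
    rw [hp]; exact mul_nonneg (mul_nonneg (hpU.1 _) ((hκ _).1 _)) ((hW _ _).1 _)
  have hWY : ∀ x s, ∑ y, ∑ y1, W x s (y, y1) = 1 := fun x s => by
    rw [← Fintype.sum_prod_type, (hW x s).2]
  have hWY1 : ∀ x s, ∑ y1, ∑ y, W x s (y, y1) = 1 := fun x s => by
    rw [Finset.sum_comm, hWY]
  let D1 : 𝒮 → Fin k × 𝒴₁ → ℝ := fun s t => ∑ x, ∑ y, p (t.1, x) * W x s (y, t.2)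
  let D0 : 𝒮 → Fin k × 𝒴 → ℝ := fun s t => ∑ x, ∑ y1, p (t.1, x) * W x s (t.2, y1)
  let D2 : 𝒮 → Fin k × 𝒳 × 𝒴 → ℝ := fun s t =>
    ∑ y1, p (t.1, t.2.1) * W t.2.1 s (t.2.2, y1)
  have hD1m : ∀ s u, ∑ y1, D1 s (u, y1) = pU u := fun s u => by
    simp only [D1]
    rw [Finset.sum_comm]
    simp_rw [← Finset.mul_sum, hWY1, hp, mul_one, ← Finset.mul_sum, (hκ _).2, mul_one]
  have hD0m : ∀ s u, ∑ y, D0 s (u, y) = pU u := fun s u => by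
    simp only [D0]
    rw [Finset.sum_comm]
    simp_rw [← Finset.mul_sum, hWY, hp, mul_one, ← Finset.mul_sum, (hκ _).2, mul_one]
  have hD1 : ∀ s, IsPMF (D1 s) := fun s =>
    ⟨fun t => Finset.sum_nonneg fun _ _ => Finset.sum_nonneg fun _ _ => hp0 _ _ _ _, by
      simp_rw [Fintype.sum_prod_type, hD1m, hpU.2]⟩
  have hD0 : ∀ s, IsPMF (D0 s) := fun s =>
    ⟨fun t => Finset.sum_nonneg fun _ _ => Finset.sum_nonneg fun _ _ => hp0 _ _ _ _, by
      simp_rw [Fintype.sum_prod_type, hD0m, hpU.2]⟩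
  obtain ⟨c1, hc1, K1, hK1, h1⟩ := exists_universal_test hP (pU := fun _ : Unit => 1)
    (κ := fun _ => pU) (fun _ => hpU) (D := fun s t => D1 s t.2) (fun s t => (hD1 s).1 _)
    (fun s _ u => by rw [hD1m, one_mul])
    (fun z => ((), z.1, z.2.2.2)) (fun s φ => by
      simp only [P, D1, Fintype.sum_prod_type, Finset.sum_mul, Finset.univ_unique,
        Finset.sum_singleton]
      refine Finset.sum_congr rfl fun u _ => ?_
      rw [Finset.sum_comm (s := (Finset.univ : Finset 𝒴₁))]
      refine Finset.sum_congr rfl fun x _ => ?_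
      rw [Finset.sum_comm]
      simp only [hp, mul_assoc]) hT1 (fun q hq => by
      have he : (fun t : Fin k × 𝒴₁ => ∑ x, ∑ s, ∑ y, p (t.1, x) * q s * W x s (y, t.2))
          = fun t => ∑ s, q s * D1 s t := by
        funext t
        simp only [D1, Finset.mul_sum]
        rw [Finset.sum_comm]
        simp only [mul_assoc, mul_left_comm]
      refine (hI1 q hq).trans_eq ?_
      rw [IqUY1, he, mutInfo_eq_condMutInfo (hq.mixture hD1)])
  obtain ⟨c0, hc0, K0, hK0, h0⟩ := exists_universal_test hP (pU := fun _ : Unit => 1)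
    (κ := fun _ => pU) (fun _ => hpU) (D := fun s t => D0 s t.2) (fun s t => (hD0 s).1 _)
    (fun s _ u => by rw [hD0m, one_mul])
    (fun z => ((), z.1, z.2.2.1)) (fun s φ => by
      simp only [P, D0, Fintype.sum_prod_type, Finset.sum_mul, Finset.univ_unique,
        Finset.sum_singleton]
      refine Finset.sum_congr rfl fun u _ => ?_
      rw [Finset.sum_comm (s := (Finset.univ : Finset 𝒴)) (t := (Finset.univ : Finset 𝒳))]
      simp only [hp, mul_assoc]) hT0 (fun q hq => by
      have he : (fun t : Fin k × 𝒴 => ∑ x, ∑ s, ∑ y1, p (t.1, x) * q s * W x s (t.2, y1))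
          = fun t => ∑ s, q s * D0 s t := by
        funext t
        simp only [D0, Finset.mul_sum]
        rw [Finset.sum_comm]
        simp only [mul_assoc, mul_left_comm]
      refine (hI0 q hq).trans_eq ?_
      rw [IqUY, he, mutInfo_eq_condMutInfo (hq.mixture hD0)])
  obtain ⟨c2, hc2, K2, hK2, h2⟩ := exists_universal_test hP (pU := pU) hκ
    (D := D2) (fun s t => Finset.sum_nonneg fun y1 _ => hp0 _ _ _ _)
    (fun s u x => by
      simp only [D2]
      simp_rw [← Finset.mul_sum, hWY, hp, mul_one])
    (fun z => (z.1, z.2.1, z.2.2.1)) (fun s φ => by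
      simp only [P, D2, Fintype.sum_prod_type, Finset.sum_mul, hp, mul_assoc]) hT2
    (fun q hq => by
      have he : (fun t : Fin k × 𝒳 × 𝒴 =>
          p (t.1, t.2.1) * ∑ s, q s * ∑ y1, W t.2.1 s (t.2.2, y1))
          = fun t => ∑ s, q s * D2 s t := by
        funext t
        simp only [D2, Finset.mul_sum, mul_left_comm]
      refine (hI2 q hq).trans_eq ?_
      rw [IqXYgivenU, he])
  refine ⟨min c1 (min c0 c2), by positivity, max K1 (max K0 K2), by positivity, fun n hn => ?_⟩
  obtain ⟨t1, h1a, h1b⟩ := h1 n hn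
  obtain ⟨t0, h0a, h0b⟩ := h0 n hn
  obtain ⟨t2, h2a, h2b⟩ := h2 n hn
  have hexp : ∀ c', min c1 (min c0 c2) ≤ c' →
      Real.exp (-(n * c')) ≤ Real.exp (-(n * min c1 (min c0 c2))) := fun c' h => by gcongr
  refine ⟨t1 fun _ => (), t0 fun _ => (), t2,
    fun y1 => (h1a (fun _ => ()) y1).trans (by gcongr; simp),
    fun y => (h0a (fun _ => ()) y).trans (by gcongr; simp),
    fun u y => (h2a u y).trans (by gcongr; simp), fun s => ?_⟩
  have e1 := (h1b s).trans (hexp c1 (by simp))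
  have e0 := (h0b s).trans (hexp c0 (by simp))
  have e2 := (h2b s).trans (hexp c2 (by simp))
  rw [← sum_block_superposition pU κ W s fun u x y y1 =>
    ind (¬ t1 (fun _ => ()) u y1) + ind (¬ t0 (fun _ => ()) u y) + ind (¬ t2 u x y)]
  simp only [mul_add, Finset.sum_add_distrib]
  linarith

/-- A random code whose error probability is controlled for every state sequence. -/
theorem exists_random_code {W : 𝒳 → 𝒮 → 𝒴 × 𝒴₁ → ℝ} (hW : IsChannel W) [Nonempty 𝒳] {k : ℕ}
    {p : Fin k × 𝒳 → ℝ} (hp : IsPMF p) {T1 T0 T2 I1 I0 I2 : ℝ}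
    (hT1 : T1 < I1) (hT0 : T0 < I0) (hT2 : T2 < I2)
    (hI1 : ∀ q, IsPMF q → I1 ≤ IqUY1 W p q * Real.log 2)
    (hI0 : ∀ q, IsPMF q → I0 ≤ IqUY W p q * Real.log 2)
    (hI2 : ∀ q, IsPMF q → I2 ≤ IqXYgivenU W p q * Real.log 2) :
    ∃ c > 0, ∃ K ≥ 0, ∀ n ≥ 1, ∀ L B N : ℕ, 1 ≤ L → 1 ≤ B → 1 ≤ N →
      ∃ (J : Type) (_ : Fintype J) (pr : J → ℝ) (Cs : J → PCode 𝒳 𝒴 𝒴₁ n (L * B * N) L),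
        IsPMF pr ∧ ∀ s : Fin n → 𝒮, ∑ j, pr j * (Cs j).errGiven W s ≤
          3 * Real.exp (-(n * c)) + (L * B - 1) * (K * Real.exp (-(n * T1)))
            + (B - 1) * (K * Real.exp (-(n * T0))) + (N - 1) * (K * Real.exp (-(n * T2))) := by
  obtain ⟨pU, κ, hpU, hκ, hpκ⟩ := hp.exists_factor
  obtain ⟨c, hc, K, hK, htests⟩ :=
    exists_block_tests hW hpU hκ hpκ hT1 hT0 hT2 hI1 hI0 hI2
  refine ⟨c, hc, K, hK, fun n hn L B N hL hB hN => ?_⟩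
  obtain ⟨t1, t0, t2, h1, h0, h2, herr⟩ := htests n hn
  have : NeZero L := ⟨by omega⟩
  have : NeZero B := ⟨by omega⟩
  have : NeZero N := ⟨by omega⟩
  obtain ⟨J, hJ, pr, hpr, f, f1, g, hcode⟩ := exists_random_block_code L B N
    (isPMF_pi (fun _ : Fin n => pU) fun _ => hpU)
    (fun u : Fin n → Fin k => isPMF_pi (fun i => κ (u i)) fun i => hκ (u i)) t1 t0 t2 h1 h0 h2
  let e : Fin L × Fin B × Fin N ≃ Fin (L * B * N) :=
    Fintype.equivFinOfCardEq (by simp [mul_assoc])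
  refine ⟨J, hJ, pr, fun j => ⟨fun m => f j (e.symm m), f1 j, fun o => e (g j o)⟩, hpr,
    fun s => ?_⟩
  have hM : (0 : ℝ) < (L * B * N : ℕ) := by exact_mod_cast Nat.mul_pos (Nat.mul_pos hL hB) hN
  have hV : ∀ x : Fin n → 𝒳, IsPMF fun o : (Fin n → 𝒴) × (Fin n → 𝒴₁) =>
      ∏ i, W (x i) (s i) (o.1 i, o.2 i) := fun x =>
    ⟨fun o => Finset.prod_nonneg fun i _ => (hW _ _).1 _, by
      rw [Fintype.sum_prod_type, ← sum_arrow_prod fun (y : Fin n → 𝒴) (y1 : Fin n → 𝒴₁) =>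
        ∏ i, W (x i) (s i) (y i, y1 i)]
      exact sum_pi_prod_eq_one (fun i => W (x i) (s i)) fun i => (hW _ _).2⟩
  have hm := hcode (fun x o => ∏ i, W (x i) (s i) (o.1 i, o.2 i)) hV
  unfold PCode.errGiven
  simp_rw [mul_left_comm (pr _)]
  rw [← Finset.mul_sum, inv_mul_le_iff₀ hM]
  simp_rw [Finset.mul_sum (Finset.univ : Finset (Fin (L * B * N)))]
  rw [Finset.sum_comm, ← nsmul_eq_mul]
  refine (Finset.sum_le_card_nsmul _ _ _ fun m _ => ?_).trans_eq
    (congrArg (· • _) (by rw [Finset.card_univ, Fintype.card_fin]))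
  refine le_trans ?_ ((hm (e.symm m)).trans ?_)
  · simp only [Equiv.eq_symm_apply, le_refl]
  · linarith [herr s]

/-- Choice of a test threshold for a rate that either vanishes or lies below an information
quantity. -/
theorem exists_threshold {t J : ℝ} (h : t = 0 ∨ t < J) :
    ∃ T < J * Real.log 2, ∃ d > 0, ∀ n : ℕ,
      ((2 : ℝ) ^ (n * t) - 1) * Real.exp (-(n * T)) ≤ Real.exp (-(n * d)) := by
  rcases h with rfl | h
  · refine ⟨J * Real.log 2 - 1, by linarith, 1, one_pos, fun n => ?_⟩
    simp [Real.exp_nonneg]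
  · have hlog := log_two_pos
    have hJ : t * Real.log 2 < J * Real.log 2 := by gcongr
    obtain ⟨T, hT1, hT2⟩ := exists_between hJ
    refine ⟨T, hT2, T - t * Real.log 2, by linarith, fun n => ?_⟩
    calc ((2 : ℝ) ^ (n * t) - 1) * Real.exp (-(n * T))
        ≤ (2 : ℝ) ^ (n * t) * Real.exp (-(n * T)) := by gcongr; linarith
      _ = Real.exp (-(n * (T - t * Real.log 2))) := by
        rw [Real.rpow_def_of_pos two_pos, ← Real.exp_add]
        congr 1
        ring

theorem exists_floor_rpow {t : ℝ} (ht : 0 ≤ t) (n : ℕ) :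
    ∃ L : ℕ, 1 ≤ L ∧ (L : ℝ) ≤ 2 ^ (n * t) ∧ (2 : ℝ) ^ (n * t) ≤ 2 * L := by
  have h1 : (1 : ℝ) ≤ 2 ^ (n * t) := Real.one_le_rpow one_le_two (by positivity)
  have hL : 1 ≤ ⌊(2 : ℝ) ^ (n * t)⌋₊ := Nat.le_floor (by simpa using h1)
  refine ⟨⌊(2 : ℝ) ^ (n * t)⌋₊, hL, Nat.floor_le (by positivity), ?_⟩
  have h2 := Nat.lt_floor_add_one ((2 : ℝ) ^ (n * t))
  have h3 : (1 : ℝ) ≤ ⌊(2 : ℝ) ^ (n * t)⌋₊ := by exact_mod_cast hL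
  linarith

theorem avrcRandAchievable_of_split {W : 𝒳 → 𝒮 → 𝒴 × 𝒴₁ → ℝ} (hW : IsChannel W) [Nonempty 𝒳]
    {k : ℕ} {p : Fin k × 𝒳 → ℝ} (hp : IsPMF p) {C1 J1 J0 J2 a b c R : ℝ}
    (hJ1 : ∀ q, IsPMF q → J1 ≤ IqUY1 W p q)
    (hJ0 : ∀ q, IsPMF q → J0 ≤ IqUY W p q)
    (hJ2 : ∀ q, IsPMF q → J2 ≤ IqXYgivenU W p q)
    (ha : 0 ≤ a) (hb : 0 ≤ b) (hc : 0 ≤ c) (haC : a ≤ C1)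
    (h1 : a + b = 0 ∨ a + b < J1) (h0 : b = 0 ∨ b < J0) (h2 : c = 0 ∨ c < J2)
    (hR : R < a + b + c) : AVRCRandAchievable W C1 R := by
  intro ε hε
  have hlog := log_two_pos
  obtain ⟨T1, hT1, d1, hd1, g1⟩ := exists_threshold h1
  obtain ⟨T0, hT0, d0, hd0, g0⟩ := exists_threshold h0
  obtain ⟨T2, hT2, d2, hd2, g2⟩ := exists_threshold h2
  obtain ⟨d3, hd3, K, hK, hcode⟩ := exists_random_code hW hp hT1 hT0 hT2
    (fun q hq => by have := hJ1 q hq; gcongr) (fun q hq => by have := hJ0 q hq; gcongr)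
    (fun q hq => by have := hJ2 q hq; gcongr)
  set d := min d3 (min d1 (min d0 d2)) with hd
  have hd0' : 0 < d := by positivity
  have hexp : ∀ (n : ℕ) d', d ≤ d' → Real.exp (-(n * d')) ≤ Real.exp (-(n * d)) :=
    fun n d' h => by gcongr
  have hlim : Filter.Tendsto (fun n : ℕ => (3 + 3 * K) * Real.exp (-(n * d))) Filter.atTop
      (nhds ((3 + 3 * K) * 0)) := by
    refine Filter.Tendsto.const_mul _ (Real.tendsto_exp_neg_atTop_nhds_zero.comp ?_)
    exact tendsto_natCast_atTop_atTop.atTop_mul_const hd0'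
  rw [mul_zero] at hlim
  obtain ⟨N1, hN1⟩ := Filter.eventually_atTop.1 (hlim.eventually_le_const hε)
  obtain ⟨N2, hN2⟩ := exists_nat_ge (3 / (a + b + c - R))
  refine ⟨max 1 (max N1 N2), fun n hn => ?_⟩
  have hn1 : 1 ≤ n := (le_max_left _ _).trans hn
  have hnN1 : N1 ≤ n := (le_max_left _ _).trans ((le_max_right _ _).trans hn)
  have hnN2 : N2 ≤ n := (le_max_right _ _).trans ((le_max_right _ _).trans hn)
  obtain ⟨L, hL1, hL, hL'⟩ := exists_floor_rpow ha n
  obtain ⟨B, hB1, hB, hB'⟩ := exists_floor_rpow hb n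
  obtain ⟨N, hNN1, hN, hN'⟩ := exists_floor_rpow hc n
  obtain ⟨J, hJ, pr, Cs, hpr, hCs⟩ := hcode n hn1 L B N hL1 hB1 hNN1
  have hLB : (L * B : ℝ) ≤ 2 ^ (n * (a + b)) := by
    rw [mul_add, Real.rpow_add two_pos]
    gcongr
  have hbound : ∀ s : Fin n → 𝒮, ∑ j, pr j * (Cs j).errGiven W s ≤ ε := fun s => by
    refine (hCs s).trans (le_trans ?_ (hN1 n hnN1))
    have e1 : (L * B - 1 : ℝ) * Real.exp (-(n * T1)) ≤ Real.exp (-(n * d)) :=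
      le_trans (by gcongr) ((g1 n).trans (hexp n d1 (by simp [hd])))
    have e0 : (B - 1 : ℝ) * Real.exp (-(n * T0)) ≤ Real.exp (-(n * d)) :=
      le_trans (by gcongr) ((g0 n).trans (hexp n d0 (by simp [hd])))
    have e2 : (N - 1 : ℝ) * Real.exp (-(n * T2)) ≤ Real.exp (-(n * d)) :=
      le_trans (by gcongr) ((g2 n).trans (hexp n d2 (by simp [hd])))
    have e3 := hexp n d3 (by simp [hd])
    linarith [mul_le_mul_of_nonneg_left e1 hK, mul_le_mul_of_nonneg_left e0 hK,
      mul_le_mul_of_nonneg_left e2 hK]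
  refine ⟨L * B * N, L, ?_, ⟨hL1, hL.trans (Real.rpow_le_rpow_of_exponent_le one_le_two
    (by gcongr))⟩, J, PMF.ofFintype (fun j => ENNReal.ofReal (pr j)) ?_, Cs, fun qn hqn => ?_⟩
  · have hgap : (n : ℝ) * R + 3 ≤ n * (a + b + c) := by
      have h3 : 3 / (a + b + c - R) ≤ n := hN2.trans (by exact_mod_cast hnN2)
      rw [div_le_iff₀ (by linarith)] at h3
      linarith
    have h8 : (2 : ℝ) ^ ((n : ℝ) * R) * 8 ≤ 2 ^ (n * a) * 2 ^ (n * b) * 2 ^ (n * c) := by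
      rw [← Real.rpow_add two_pos, ← Real.rpow_add two_pos]
      calc (2 : ℝ) ^ ((n : ℝ) * R) * 8 = 2 ^ ((n : ℝ) * R + 3) := by
            rw [Real.rpow_add two_pos]; norm_num
        _ ≤ _ := Real.rpow_le_rpow_of_exponent_le one_le_two (by linarith)
    have h9 : (2 : ℝ) ^ (n * a) * 2 ^ (n * b) * 2 ^ (n * c) ≤ (2 * L) * (2 * B) * (2 * N) := by
      gcongr
    push_cast
    linarith
  · rw [← ENNReal.ofReal_sum_of_nonneg fun j _ => hpr.1 j, hpr.2, ENNReal.ofReal_one]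
  · have herr0 : ∀ j s, 0 ≤ (Cs j).errGiven W s := fun j s =>
      mul_nonneg (by positivity) (Finset.sum_nonneg fun m _ => Finset.sum_nonneg fun y _ =>
        Finset.sum_nonneg fun y1 _ => by
          split_ifs
          · exact le_rfl
          · exact Finset.prod_nonneg fun i _ => (hW _ _).1 _)
    rw [tsum_fintype]
    simp only [PMF.ofFintype_apply, PCode.errJoint]
    simp_rw [← ENNReal.ofReal_mul (hpr.1 _)]
    rw [← ENNReal.ofReal_sum_of_nonneg fun j _ => mul_nonneg (hpr.1 j)
      (Finset.sum_nonneg fun s _ => mul_nonneg (hqn.1 s) (herr0 j s))]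
    refine ENNReal.ofReal_le_ofReal ?_
    simp_rw [Finset.mul_sum, mul_left_comm (pr _)]
    rw [Finset.sum_comm]
    simp_rw [← Finset.mul_sum]
    calc ∑ s, qn s * ∑ j, pr j * (Cs j).errGiven W s ≤ ∑ s, qn s * ε :=
          Finset.sum_le_sum fun s _ => mul_le_mul_of_nonneg_left (hbound s) (hqn.1 s)
      _ = ε := by rw [← Finset.sum_mul, hqn.2, one_mul]

theorem IqUY1_nonneg {W : 𝒳 → 𝒮 → 𝒴 × 𝒴₁ → ℝ} (hW : IsChannel W) {k : ℕ}
    {p : Fin k × 𝒳 → ℝ} (hp : IsPMF p) {q : 𝒮 → ℝ} (hq : IsPMF q) : 0 ≤ IqUY1 W p q := by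
  refine mutInfo_nonneg ⟨fun t => Finset.sum_nonneg fun x _ => Finset.sum_nonneg fun s _ =>
    Finset.sum_nonneg fun y _ => mul_nonneg (mul_nonneg (hp.1 _) (hq.1 _)) ((hW _ _).1 _), ?_⟩
  have hWsum : ∀ x s, ∑ y1, ∑ y, W x s (y, y1) = 1 := fun x s => by
    rw [Finset.sum_comm, ← Fintype.sum_prod_type, (hW x s).2]
  have h : ∀ u, ∑ y1, ∑ x, ∑ s, ∑ y, p (u, x) * q s * W x s (y, y1) = ∑ x, p (u, x) := fun u => by
    rw [Finset.sum_comm]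
    refine Finset.sum_congr rfl fun x _ => ?_
    rw [Finset.sum_comm]
    simp_rw [← Finset.mul_sum, hWsum, mul_one, ← Finset.mul_sum, hq.2, mul_one]
  simp_rw [Fintype.sum_prod_type, h, ← Fintype.sum_prod_type, hp.2]

theorem IqUY_nonneg {W : 𝒳 → 𝒮 → 𝒴 × 𝒴₁ → ℝ} (hW : IsChannel W) {k : ℕ}
    {p : Fin k × 𝒳 → ℝ} (hp : IsPMF p) {q : 𝒮 → ℝ} (hq : IsPMF q) : 0 ≤ IqUY W p q := by
  refine mutInfo_nonneg ⟨fun t => Finset.sum_nonneg fun x _ => Finset.sum_nonneg fun s _ =>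
    Finset.sum_nonneg fun y _ => mul_nonneg (mul_nonneg (hp.1 _) (hq.1 _)) ((hW _ _).1 _), ?_⟩
  have hWsum : ∀ x s, ∑ y, ∑ y1, W x s (y, y1) = 1 := fun x s => by
    rw [← Fintype.sum_prod_type, (hW x s).2]
  have h : ∀ u, ∑ y, ∑ x, ∑ s, ∑ y1, p (u, x) * q s * W x s (y, y1) = ∑ x, p (u, x) := fun u => by
    rw [Finset.sum_comm]
    refine Finset.sum_congr rfl fun x _ => ?_
    rw [Finset.sum_comm]
    simp_rw [← Finset.mul_sum, hWsum, mul_one, ← Finset.mul_sum, hq.2, mul_one]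
  simp_rw [Fintype.sum_prod_type, h, ← Fintype.sum_prod_type, hp.2]

theorem IqXYgivenU_nonneg {W : 𝒳 → 𝒮 → 𝒴 × 𝒴₁ → ℝ} (hW : IsChannel W) {k : ℕ}
    {p : Fin k × 𝒳 → ℝ} (hp : IsPMF p) {q : 𝒮 → ℝ} (hq : IsPMF q) : 0 ≤ IqXYgivenU W p q :=
  condMutInfo_nonneg fun _ => mul_nonneg (hp.1 _) (Finset.sum_nonneg fun s _ =>
    mul_nonneg (hq.1 s) (Finset.sum_nonneg fun _ _ => (hW _ _).1 _))

theorem exists_strict_approx {T δ : ℝ} (hT : 0 ≤ T) (hδ : 0 < δ) :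
    ∃ t, 0 ≤ t ∧ T - δ < t ∧ (t = 0 ∨ t < T) := by
  rcases hT.eq_or_lt with rfl | hT
  · exact ⟨0, le_rfl, by linarith, Or.inl rfl⟩
  · refine ⟨max 0 (T - δ / 2), le_max_left _ _, lt_max_of_lt_right (by linarith), Or.inr ?_⟩
    exact max_lt hT (by linarith)

/-- Splitting a rate below the decode-forward bound into relayed, directly decoded and satellite
parts. -/
theorem exists_rate_split {I0 I1 I2 C1 R : ℝ} (hI0 : 0 ≤ I0) (hI1 : 0 ≤ I1) (hI2 : 0 ≤ I2)
    (hC1 : 0 ≤ C1) (hR : R < min (I0 + I2 + C1) (I1 + I2)) :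
    ∃ a b c, 0 ≤ a ∧ 0 ≤ b ∧ 0 ≤ c ∧ a ≤ C1 ∧ (a + b = 0 ∨ a + b < I1) ∧ (b = 0 ∨ b < I0) ∧
      (c = 0 ∨ c < I2) ∧ R < a + b + c := by
  obtain ⟨hR0, hR1⟩ := lt_min_iff.1 hR
  have hT : R - I2 < min (I0 + C1) I1 := lt_min (by linarith) (by linarith)
  set T := min (I0 + C1) I1 with hTdef
  have hTle0 : T ≤ I0 + C1 := min_le_left _ _
  have hTle1 : T ≤ I1 := min_le_right _ _
  have hT0 : 0 ≤ T := by positivity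
  obtain ⟨t, ht0, ht, htT⟩ := exists_strict_approx hT0 (δ := (T - (R - I2)) / 2) (by linarith)
  obtain ⟨c, hc0, hc, hcI⟩ := exists_strict_approx hI2 (δ := (T - (R - I2)) / 2) (by linarith)
  refine ⟨min C1 t, t - min C1 t, c, le_min hC1 ht0, sub_nonneg.2 (min_le_right _ _), hc0,
    min_le_left _ _, ?_, ?_, hcI, by linarith⟩
  · rw [add_sub_cancel]
    exact htT.imp_right fun h => h.trans_le hTle1
  · rcases le_total C1 t with h | h
    · rw [min_eq_left h]
      exact htT.imp (fun h0 => by linarith) fun h1 => by linarith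
    · rw [min_eq_right h]
      exact Or.inl (sub_self t)

/-- Every rate below the partial decode-forward expression of an input pmf is achievable by
random codes. -/
theorem avrcRandAchievable_of_lt {W : 𝒳 → 𝒮 → 𝒴 × 𝒴₁ → ℝ} (hW : IsChannel W) [Nonempty 𝒳]
    {k : ℕ} {p : Fin k × 𝒳 → ℝ} (hp : IsPMF p) {C1 R : ℝ} (hC1 : 0 ≤ C1)
    (hR : R < min
      (sInf {v | ∃ q ∈ {q : 𝒮 → ℝ | IsPMF q}, v = IqUY W p q}
        + sInf {v | ∃ q ∈ {q : 𝒮 → ℝ | IsPMF q}, v = IqXYgivenU W p q} + C1)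
      (sInf {v | ∃ q ∈ {q : 𝒮 → ℝ | IsPMF q}, v = IqUY1 W p q}
        + sInf {v | ∃ q ∈ {q : 𝒮 → ℝ | IsPMF q}, v = IqXYgivenU W p q})) :
    AVRCRandAchievable W C1 R := by
  have key : ∀ F : (𝒮 → ℝ) → ℝ, (∀ q, IsPMF q → 0 ≤ F q) →
      0 ≤ sInf {v | ∃ q ∈ {q : 𝒮 → ℝ | IsPMF q}, v = F q} ∧
      ∀ q, IsPMF q → sInf {v | ∃ q ∈ {q : 𝒮 → ℝ | IsPMF q}, v = F q} ≤ F q := fun F hF => by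
    have h0 : ∀ v ∈ {v | ∃ q ∈ {q : 𝒮 → ℝ | IsPMF q}, v = F q}, 0 ≤ v := by
      rintro v ⟨q, hq, rfl⟩
      exact hF q hq
    exact ⟨Real.sInf_nonneg h0, fun q hq => csInf_le ⟨0, h0⟩ ⟨q, hq, rfl⟩⟩
  obtain ⟨n0, l0⟩ := key _ fun q hq => IqUY_nonneg hW hp hq
  obtain ⟨n1, l1⟩ := key _ fun q hq => IqUY1_nonneg hW hp hq
  obtain ⟨n2, l2⟩ := key _ fun q hq => IqXYgivenU_nonneg hW hp hq
  obtain ⟨a, b, c, ha, hb, hc, haC, h1, h0, h2, hlt⟩ := exists_rate_split n0 n1 n2 hC1 hR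
  exact avrcRandAchievable_of_split hW hp l1 l0 l2 ha hb hc haC h1 h0 h2 hlt

theorem exists_isPMF (α : Type) [Fintype α] [Nonempty α] : ∃ p : α → ℝ, IsPMF p := by
  classical
  refine ⟨Pi.single (Classical.arbitrary α) 1, fun a => ?_, by simp [Pi.single_apply]⟩
  by_cases ha : a = Classical.arbitrary α <;> simp [ha]

end Achievability

/-- Without states there is no state distribution, and every rate is vacuously achievable. -/
theorem avrcRandAchievable_of_isEmpty {𝒳 𝒮 𝒴 𝒴₁ : Type} [Fintype 𝒮] [Fintype 𝒴] [Fintype 𝒴₁]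
    [IsEmpty 𝒮] [Nonempty 𝒳] (W : 𝒳 → 𝒮 → 𝒴 × 𝒴₁ → ℝ) {C1 : ℝ} (hC1 : 0 ≤ C1) (R : ℝ) :
    AVRCRandAchievable W C1 R := by
  intro ε _
  refine ⟨1, fun n hn => ⟨⌈(2 : ℝ) ^ ((n : ℝ) * R)⌉₊, 1, Nat.le_ceil _, ⟨le_rfl, ?_⟩, Unit,
    PMF.pure (), fun _ => ⟨fun _ _ => Classical.arbitrary 𝒳, fun _ => 0, fun _ =>
      ⟨0, Nat.ceil_pos.2 (by positivity)⟩⟩, fun qn hqn => ?_⟩⟩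
  · rw [Nat.cast_one]
    exact Real.one_le_rpow one_le_two (by positivity)
  · have : IsEmpty (Fin n → 𝒮) := ⟨fun s => isEmptyElim (s ⟨0, hn⟩)⟩
    have := hqn.2
    simp at this

/-- The random code capacity of a primitive AVRC is bounded between the partial
decode-forward bound and the cutset bound, both evaluated with the state set equal
to the whole simplex of pmfs on `𝒮`. -/
theorem avrc_randomCapacity_bounds
    {𝒳 𝒮 𝒴 𝒴₁ : Type} [Fintype 𝒳] [Fintype 𝒮] [Fintype 𝒴] [Fintype 𝒴₁] [Nonempty 𝒳]
    (W : 𝒳 → 𝒮 → 𝒴 × 𝒴₁ → ℝ) (hW : IsChannel W)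
    (C1 : ℝ) (hC1 : 0 ≤ C1) :
    RDF W C1 {q : 𝒮 → ℝ | IsPMF q} ≤ AVRCRandCapacity W C1 ∧
    AVRCRandCapacity W C1 ≤ RCS W C1 {q : 𝒮 → ℝ | IsPMF q} := by
  rcases isEmpty_or_nonempty 𝒮 with h𝒮 | h𝒮
  · have hQ : {q : 𝒮 → ℝ | IsPMF q} = ∅ := Set.eq_empty_of_forall_notMem fun q hq => by
      have := hq.2
      simp at this
    have hcap : AVRCRandCapacity W C1 = 0 := by
      rw [AVRCRandCapacity, Set.eq_univ_of_forall (s := {R | AVRCRandAchievable W C1 R})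
        fun R => avrcRandAchievable_of_isEmpty W hC1 R, Real.sSup_univ]
    rw [hcap, hQ]
    constructor
    · refine Real.sSup_nonpos ?_
      rintro r ⟨k, p, _, rfl⟩
      simp
    · simp [RCS]
  · obtain ⟨q₀, hq₀⟩ := exists_isPMF 𝒮
    obtain ⟨p₀, hp₀⟩ := exists_isPMF (Fin 1 × 𝒳)
    have hbdd : BddAbove {R | AVRCRandAchievable W C1 R} := ⟨_, fun R hR => hR.le_cutset hW hq₀⟩
    constructor
    · refine csSup_le ⟨_, 1, p₀, hp₀, rfl⟩ ?_
      rintro r ⟨k, p, hp, rfl⟩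
      exact le_of_forall_lt fun R hR => by
        obtain ⟨R', hRR', hR'⟩ := exists_between hR
        exact hRR'.trans_le (le_csSup hbdd (avrcRandAchievable_of_lt hW hp hC1 hR'))
    · refine le_csInf ⟨_, q₀, hq₀, rfl⟩ ?_
      rintro r ⟨q, hq, rfl⟩
      obtain ⟨R, hR⟩ := exists_lt (min
        (sInf {v | ∃ q ∈ {q : 𝒮 → ℝ | IsPMF q}, v = IqUY W p₀ q}
          + sInf {v | ∃ q ∈ {q : 𝒮 → ℝ | IsPMF q}, v = IqXYgivenU W p₀ q} + C1)
        (sInf {v | ∃ q ∈ {q : 𝒮 → ℝ | IsPMF q}, v = IqUY1 W p₀ q}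
          + sInf {v | ∃ q ∈ {q : 𝒮 → ℝ | IsPMF q}, v = IqXYgivenU W p₀ q}))
      exact csSup_le ⟨R, avrcRandAchievable_of_lt hW hp₀ hC1 hR⟩ fun R hR => hR.le_cutset hW hq
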